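/- Let p ≡ 5 (mod 8) be a prime, q a prime with (ℤ/pℤ)* generated by -1 and q, and ζ ∈ F_{q^{p-1}} a primitive p-th root of unity. If ind(α) denotes (q^{(p-1)/2} - 1)/ord(α) for α = ζ + ζ⁻¹ ∈ F_{q^{(p-1)/2}}*, then gcd(ind(α), q² - 1) = ind(ε_p^{h_p} mod qO_K), where ε_p and h_p are the fundamental unit and class number of K = ℚ(√p) and q is inert in K. -/

import Mathlib

open NumberField

open Filter Topology Complex MeasureTheory Set in
/-- Abel-type evaluation of the polylogarithm on the unit circle at `s = 1`. -/
theorem tendsto_LSeries_pow_nhdsGT_one {z : ℂ} (hz : ‖z‖ = 1) (hz1 : z ≠ 1) :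
    Tendsto (fun s : ℝ ↦ LSeries (fun n ↦ z ^ n) s) (𝓝[>] 1) (𝓝 (-log (1 - z))) := by
  set F : ℝ → ℂ := fun t ↦ z * Real.exp (-t) / (1 - z * Real.exp (-t)) with hF
  have hexp : ∀ t : ℝ, 0 < t → ‖z * Real.exp (-t)‖ < 1 := fun t ht ↦ by
    rw [norm_mul, hz, one_mul, norm_real, Real.norm_eq_abs, Real.abs_exp, Real.exp_lt_one_iff]
    linarith
  have hexp' : ∀ t : ℝ, 0 ≤ t → ‖z * Real.exp (-t)‖ ≤ 1 := fun t ht ↦ by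
    rw [norm_mul, hz, one_mul, norm_real, Real.norm_eq_abs, Real.abs_exp, Real.exp_le_one_iff]
    linarith
  obtain ⟨c, hc, hcF⟩ : ∃ c : ℝ, 0 < c ∧ ∀ t : ℝ, 0 ≤ t → c ≤ ‖1 - z * Real.exp (-t)‖ := by
    obtain ⟨x, hx, hmin⟩ := (isCompact_Icc (a := (0 : ℝ)) (b := 1)).exists_isMinOn
      (nonempty_Icc.2 zero_le_one) (f := fun x : ℝ ↦ ‖1 - z * x‖) (by fun_prop)
    refine ⟨‖1 - z * x‖, ?_, fun t ht ↦ hmin ⟨(Real.exp_pos _).le, by simpa using ht⟩⟩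
    rw [norm_pos_iff, sub_ne_zero]
    intro h
    have h1 := congrArg norm h
    rw [norm_mul, hz, one_mul, norm_one, norm_real, Real.norm_of_nonneg hx.1] at h1
    rw [← h1] at h
    exact hz1 (by simpa using h.symm)
  have hF_sum : ∀ t ∈ Ioi (0 : ℝ), HasSum
      (fun n : ℕ ↦ (if n = 0 then 0 else z ^ n) * ((Real.exp (-(n : ℝ) * t) : ℝ) : ℂ)) (F t) := by
    intro t ht
    have h := (hasSum_geometric_of_norm_lt_one (hexp t ht)).mul_left (z * Real.exp (-t))
    simp only [hF, div_eq_mul_inv]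
    rw [← hasSum_nat_add_iff' 1]
    convert! h using 1
    · ext n
      simp only [Nat.add_eq_zero_iff, one_ne_zero, and_false, if_false]
      rw [← pow_succ', mul_pow, ← ofReal_pow, ← Real.exp_nat_mul]
      congr 3
      push_cast; ring
    · simp
  have hF_norm : ∀ t ∈ Ioi (0 : ℝ), ‖F t‖ ≤ Real.exp (-t) / c := by
    intro t ht
    rw [hF, norm_div, norm_mul, hz, one_mul, norm_real, Real.norm_eq_abs, Real.abs_exp]
    gcongr
    exact hcF t (le_of_lt ht)
  have hF_cont : ContinuousOn F (Ioi 0) := by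
    apply ContinuousOn.div (by fun_prop) (by fun_prop)
    intro t ht h
    have := hcF t (le_of_lt ht)
    rw [h, norm_zero] at this
    linarith
  have hmellin : ∀ s : ℝ, 1 < s →
      LSeries (fun n ↦ z ^ n) s =
        (∫ t in Ioi (0 : ℝ), (t : ℂ) ^ ((s : ℂ) - 1) * F t) / Gamma s := by
    intro s hs
    have h := hasSum_mellin (a := fun n : ℕ ↦ if n = 0 then 0 else z ^ n) (p := fun n ↦ (n : ℝ))
      (F := F) (s := s) (fun n ↦ by
        rcases Nat.eq_zero_or_pos n with h | h
        · simp [h]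
        · exact .inr (by exact_mod_cast h)) (by simp; linarith) hF_sum (by
        refine (Real.summable_one_div_nat_rpow.2 hs).of_nonneg_of_le (fun n ↦ by positivity) ?_
        intro n
        simp only [ofReal_re]
        gcongr
        split_ifs <;> simp [hz])
    have hΓ : Gamma s ≠ 0 := Gamma_ne_zero_of_re_pos (by simp; linarith)
    have h2 := (h.div_const (Gamma s)).tsum_eq
    rw [mellin] at h2
    simp only [smul_eq_mul] at h2
    rw [← h2, LSeries]
    congr 1
    ext n
    rcases eq_or_ne n 0 with rfl | hn
    · simp
    · rw [LSeries.term_of_ne_zero hn, if_neg hn]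
      simp only [ofReal_natCast]
      field_simp
  have hlim : Tendsto (fun s : ℝ ↦ ∫ t in Ioi (0 : ℝ), (t : ℂ) ^ ((s : ℂ) - 1) * F t) (𝓝[>] 1)
      (𝓝 (∫ t in Ioi (0 : ℝ), F t)) := by
    refine tendsto_integral_filter_of_dominated_convergence
      (fun t ↦ (1 + t) * (Real.exp (-t) / c)) ?_ ?_ ?_ ?_
    · refine Eventually.of_forall fun s ↦ ContinuousOn.aestronglyMeasurable ?_ measurableSet_Ioi
      refine ContinuousOn.mul (fun t ht ↦ ?_) hF_cont
      exact (continuousAt_ofReal_cpow_const _ _ (.inr (ne_of_gt ht))).continuousWithinAt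
    · filter_upwards [Ioo_mem_nhdsGT (show (1 : ℝ) < 2 by norm_num)] with s hs
      filter_upwards [ae_restrict_mem measurableSet_Ioi] with t ht
      have ht' : (0 : ℝ) < t := ht
      rw [norm_mul]
      refine mul_le_mul ?_ (hF_norm t ht) (norm_nonneg _) (by linarith)
      rw [norm_cpow_eq_rpow_re_of_pos ht]
      simp only [sub_re, ofReal_re, one_re]
      rcases le_total t 1 with h | h
      · linarith [Real.rpow_le_one ht'.le h (show 0 ≤ s - 1 by linarith [hs.1])]
      · have := Real.rpow_le_rpow_of_exponent_le h (show s - 1 ≤ 1 by linarith [hs.2])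
        rw [Real.rpow_one] at this
        linarith
    · have h1 := Real.GammaIntegral_convergent (s := 1) one_pos
      have h2 := Real.GammaIntegral_convergent (s := 2) two_pos
      refine IntegrableOn.congr_fun (f := fun t ↦ (Real.exp (-t) * t ^ ((1 : ℝ) - 1) +
        Real.exp (-t) * t ^ ((2 : ℝ) - 1)) / c) ((h1.add h2).div_const c) (fun t ht ↦ ?_)
        measurableSet_Ioi
      norm_num
      ring
    · filter_upwards [ae_restrict_mem measurableSet_Ioi] with t ht
      have : Tendsto (fun s : ℝ ↦ (t : ℂ) ^ ((s : ℂ) - 1)) (𝓝[>] 1)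
          (𝓝 ((t : ℂ) ^ ((1 : ℝ) - 1 : ℂ))) := by
        refine Tendsto.mono_left (Continuous.tendsto ?_ _) nhdsWithin_le_nhds
        exact Continuous.const_cpow (by fun_prop) (.inl (by exact_mod_cast (ne_of_gt ht)))
      simpa using this.mul_const (F t)
  have hint : ∫ t in Ioi (0 : ℝ), F t = -log (1 - z) := by
    have hslit : ∀ t : ℝ, 0 ≤ t → 1 - z * Real.exp (-t) ∈ slitPlane := by
      intro t ht
      have h1 := hexp' t ht
      have h2 := hcF t ht
      rw [mem_slitPlane_iff]
      by_contra! hcon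
      have hre := (abs_le.1 ((abs_re_le_norm (z * Real.exp (-t))).trans h1)).2
      simp only [sub_re, one_re, sub_im, one_im] at hcon
      have : 1 - z * Real.exp (-t) = 0 := by
        apply Complex.ext <;> simp only [sub_re, one_re, sub_im, one_im, zero_re, zero_im]
        · linarith [hcon.1]
        · exact hcon.2
      rw [this, norm_zero] at h2
      linarith
    have hderiv : ∀ t ∈ Ici (0 : ℝ),
        HasDerivAt (fun t : ℝ ↦ log (1 - z * Real.exp (-t))) (F t) t := by
      intro t ht
      have h1 : HasDerivAt (fun t : ℝ ↦ 1 - z * (Real.exp (-t) : ℂ)) (z * Real.exp (-t)) t := by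
        have h0 := ((((hasDerivAt_id t).neg).exp).ofReal_comp.const_mul z).const_sub 1
        convert! h0 using 1
        simp
      exact h1.clog_real (hslit t ht)
    rw [integral_Ioi_of_hasDerivAt_of_tendsto' (m := 0) hderiv]
    · simp
    · have h1 := Real.GammaIntegral_convergent (s := 1) one_pos
      refine Integrable.mono' (h1.div_const c)
        (hF_cont.aestronglyMeasurable measurableSet_Ioi) ?_
      filter_upwards [ae_restrict_mem measurableSet_Ioi] with t ht
      rw [sub_self, Real.rpow_zero, mul_one]
      exact hF_norm t ht
    · have h1 : Tendsto (fun t : ℝ ↦ 1 - z * (Real.exp (-t) : ℂ)) atTop (𝓝 (1 - z * (0 : ℝ))) := by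
        refine Tendsto.const_sub 1 (Tendsto.const_mul z ?_)
        exact (continuous_ofReal.tendsto _).comp (Real.tendsto_exp_neg_atTop_nhds_zero)
      simpa using h1.clog (by simp)
  have hΓ : Tendsto (fun s : ℝ ↦ Gamma (s : ℂ)) (𝓝[>] 1) (𝓝 1) := by
    have : ContinuousAt (fun s : ℝ ↦ Gamma (s : ℂ)) 1 := by
      refine ContinuousAt.comp (g := Gamma) ?_ continuous_ofReal.continuousAt
      exact (differentiableAt_Gamma_one).continuousAt
    have h := this.tendsto.mono_left (nhdsWithin_le_nhds (s := Ioi 1))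
    simpa using h
  have := hlim.div hΓ one_ne_zero
  rw [hint, div_one] at this
  refine this.congr' ?_
  filter_upwards [self_mem_nhdsWithin] with s hs
  exact (hmellin s hs).symm

/-- The quadratic character modulo `p` with values in a ring `R`. -/
noncomputable def quadraticCharTo (p : ℕ) [Fact p.Prime] (R : Type*) [CommRing R] :
    MulChar (ZMod p) R :=
  (quadraticChar (ZMod p)).ringHomComp (Int.castRingHom R)

section QuadraticChar

variable {p : ℕ} [Fact p.Prime] {R : Type*} [CommRing R]

theorem quadraticCharTo_apply (a : ZMod p) :
    quadraticCharTo p R a = ((quadraticChar (ZMod p) a : ℤ) : R) := rfl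

theorem quadraticCharTo_isQuadratic : (quadraticCharTo p R).IsQuadratic :=
  MulChar.IsQuadratic.comp (quadraticChar_isQuadratic (ZMod p)) _

theorem ringChar_zmod_ne_two (hp4 : p % 4 = 1) : ringChar (ZMod p) ≠ 2 := by
  rw [ZMod.ringChar_zmod_n]
  omega

theorem quadraticCharTo_ne_one [CharZero R] (hp4 : p % 4 = 1) : quadraticCharTo p R ≠ 1 := by
  obtain ⟨a, ha⟩ := quadraticChar_exists_neg_one' (ringChar_zmod_ne_two hp4)
  intro h
  have h1 := congrArg (fun χ : MulChar (ZMod p) R ↦ χ a) h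
  simp only [quadraticCharTo_apply, ha, MulChar.one_apply_coe] at h1
  have h2 : (-1 : ℤ) = 1 := by exact_mod_cast h1
  omega

theorem quadraticChar_neg_one_eq_one (hp4 : p % 4 = 1) : quadraticChar (ZMod p) (-1) = 1 := by
  rw [quadraticChar_neg_one (ringChar_zmod_ne_two hp4), ZMod.card,
    ZMod.χ₄_nat_one_mod_four hp4]

/-- The square of the quadratic Gauss sum attached to a primitive `p`-th root of unity. -/
theorem gaussSum_quadraticCharTo_sq [IsDomain R] [CharZero R] (hp4 : p % 4 = 1) {ζ : R}
    (hζ : IsPrimitiveRoot ζ p) :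
    gaussSum (quadraticCharTo p R) (AddChar.zmodChar p hζ.pow_eq_one) ^ 2 = p := by
  rw [gaussSum_sq (χ := quadraticCharTo p R) (quadraticCharTo_ne_one hp4)
    quadraticCharTo_isQuadratic (AddChar.zmodChar_primitive_of_primitive_root p hζ),
    quadraticCharTo_apply, quadraticChar_neg_one_eq_one hp4, ZMod.card]
  simp

theorem gaussSum_mul_quadraticCharTo [IsDomain R] [CharZero R] (hp4 : p % 4 = 1) {ζ : R}
    (hζ : IsPrimitiveRoot ζ p) (n : ℕ) :
    gaussSum (quadraticCharTo p R) (AddChar.zmodChar p hζ.pow_eq_one) * quadraticCharTo p R n =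
      ∑ a : ZMod p, quadraticCharTo p R a * (ζ ^ a.val) ^ n := by
  have hshift : ∑ a : ZMod p, quadraticCharTo p R a * (ζ ^ a.val) ^ n =
      gaussSum (quadraticCharTo p R) ((AddChar.zmodChar p hζ.pow_eq_one).mulShift n) := by
    refine Finset.sum_congr rfl fun a _ ↦ ?_
    rw [AddChar.mulShift_apply, ← nsmul_eq_mul, AddChar.map_nsmul_eq_pow, AddChar.zmodChar_apply]
  rw [hshift]
  by_cases hn : IsUnit (n : ZMod p)
  · rw [← hn.unit_spec, gaussSum_mulShift_eq, quadraticCharTo_isQuadratic.inv, mul_comm]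
  · rw [isUnit_iff_ne_zero, not_not] at hn
    rw [hn, MulChar.map_zero, mul_zero, AddChar.mulShift_zero]
    simp [gaussSum, MulChar.sum_eq_zero_of_ne_one (quadraticCharTo_ne_one hp4)]

end QuadraticChar

open Filter Topology in
/-- If the `L`-series of the quadratic character mod `p` tends to a real number at `1⁺`, then this
limit is given, up to sign, by logarithms of cyclotomic numbers. -/
theorem abs_mul_sqrt_eq_of_tendsto_LSeries {p : ℕ} [Fact p.Prime] (hp4 : p % 4 = 1) {ζ : ℂ}
    (hζ : IsPrimitiveRoot ζ p) {r : ℝ}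
    (hr : Tendsto (fun s : ℝ ↦ LSeries (fun n ↦ quadraticCharTo p ℂ n) s) (𝓝[>] 1) (𝓝 (r : ℂ))) :
    |r| * √p =
      |∑ a : ZMod p, (quadraticChar (ZMod p) a : ℝ) * Real.log ‖1 - ζ ^ a.val‖| := by
  set τ := gaussSum (quadraticCharTo p ℂ) (AddChar.zmodChar p hζ.pow_eq_one)
  have hτ : τ ^ 2 = p := gaussSum_quadraticCharTo_sq hp4 hζ
  have hnorm : ‖ζ‖ = 1 := Complex.norm_eq_one_of_pow_eq_one hζ.pow_eq_one (NeZero.ne p)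
  have hL : ∀ s : ℝ, 1 < s → τ * LSeries (fun n ↦ quadraticCharTo p ℂ n) s =
      ∑ a : ZMod p, quadraticCharTo p ℂ a * LSeries (fun n ↦ (ζ ^ a.val) ^ n) s := by
    intro s hs
    have hsum : ∀ a : ZMod p, LSeriesSummable (fun n ↦ (ζ ^ a.val) ^ n) s := fun a ↦
      LSeriesSummable_of_bounded_of_one_lt_real (m := 1) (fun n _ ↦ by simp [hnorm]) hs
    calc _ = LSeries (τ • fun n : ℕ ↦ quadraticCharTo p ℂ n) s := by rw [LSeries_smul]
      _ = LSeries (∑ a : ZMod p, quadraticCharTo p ℂ a • fun n : ℕ ↦ (ζ ^ a.val) ^ n) s := by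
          congr 1
          ext n
          simpa using gaussSum_mul_quadraticCharTo hp4 hζ n
      _ = _ := by
          rw [LSeries_sum fun a _ ↦ (hsum a).smul _]
          simp only [LSeries_smul]
  have hlim : Tendsto (fun s : ℝ ↦ τ * LSeries (fun n ↦ quadraticCharTo p ℂ n) s) (𝓝[>] 1)
      (𝓝 (∑ a : ZMod p, quadraticCharTo p ℂ a * -Complex.log (1 - ζ ^ a.val))) := by
    refine Tendsto.congr' (f₁ := fun s : ℝ ↦
      ∑ a : ZMod p, quadraticCharTo p ℂ a * LSeries (fun n ↦ (ζ ^ a.val) ^ n) s) ?_ ?_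
    · filter_upwards [self_mem_nhdsWithin] with s hs
      exact (hL s hs).symm
    · refine tendsto_finsetSum _ fun a _ ↦ ?_
      rcases eq_or_ne a 0 with rfl | ha
      · simp [MulChar.map_zero]
      · refine (tendsto_LSeries_pow_nhdsGT_one (by simp [hnorm]) fun h ↦ ?_).const_mul _
        have := Nat.le_of_dvd (ZMod.val_pos.2 ha) ((hζ.pow_eq_one_iff_dvd _).1 h)
        exact absurd (ZMod.val_lt a) (not_lt.2 this)
  have heq := tendsto_nhds_unique (hr.const_mul τ) hlim
  have hτr : ∃ t : ℝ, τ = t ∧ |t| = √p := by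
    have hsq : ((√p : ℝ) : ℂ) ^ 2 = p := by
      rw [← Complex.ofReal_pow, Real.sq_sqrt (Nat.cast_nonneg _)]; simp
    rcases sq_eq_sq_iff_eq_or_eq_neg.1 (hτ.trans hsq.symm) with h | h
    · exact ⟨_, h, abs_of_nonneg (Real.sqrt_nonneg _)⟩
    · exact ⟨-√p, by rw [h]; simp, by rw [abs_neg, abs_of_nonneg (Real.sqrt_nonneg _)]⟩
  obtain ⟨t, ht, ht'⟩ := hτr
  rw [ht] at heq
  have hre := congrArg Complex.re heq
  rw [← Complex.ofReal_mul, Complex.ofReal_re, Complex.re_sum] at hre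
  rw [mul_comm, ← ht', ← abs_mul, hre, ← abs_neg, ← Finset.sum_neg_distrib]
  congr 1
  refine Finset.sum_congr rfl fun a _ ↦ ?_
  rw [quadraticCharTo_apply, mul_neg, Complex.neg_re, neg_neg, ← Complex.ofReal_intCast,
    Complex.re_ofReal_mul, Complex.log_re]

section RealQuadraticField

variable {p : ℕ} {K : Type*} [Field K] [NumberField K] {α : K}

theorem algebraMap_rat_ne_of_sq_eq_prime (hp : p.Prime) (hα : α ^ 2 = p) (x : ℚ) :
    algebraMap ℚ K x ≠ α := by
  rintro rfl
  rw [← map_pow, ← map_natCast (algebraMap ℚ K)] at hα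
  have h := (algebraMap ℚ K).injective hα
  have : IsSquare ((p : ℕ) : ℚ) := ⟨x, by rw [← h, sq]⟩
  exact hp.prime.irreducible.not_isSquare (Rat.isSquare_natCast_iff.1 this)

theorem linearIndependent_one_sqrt (hp : p.Prime) (hα : α ^ 2 = p) :
    LinearIndependent ℚ ![1, α] := by
  refine (LinearIndependent.pair_iff' one_ne_zero).2 fun a h ↦ ?_
  exact algebraMap_rat_ne_of_sq_eq_prime hp hα a (by rw [← h, Algebra.smul_def, mul_one])

/-- The basis `1, α` of a quadratic field containing a square root `α` of a prime. -/
noncomputable def basisOneSqrt (hp : p.Prime) (hα : α ^ 2 = p) (hdeg : Module.finrank ℚ K = 2) :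
    Module.Basis (Fin 2) ℚ K :=
  basisOfLinearIndependentOfCardEqFinrank (linearIndependent_one_sqrt hp hα) (by simp [hdeg])

theorem coe_basisOneSqrt (hp : p.Prime) (hα : α ^ 2 = p) (hdeg : Module.finrank ℚ K = 2) :
    ⇑(basisOneSqrt hp hα hdeg) = ![1, α] :=
  coe_basisOfLinearIndependentOfCardEqFinrank _ _

theorem exists_rat_add_mul_sqrt (hp : p.Prime) (hα : α ^ 2 = p)
    (hdeg : Module.finrank ℚ K = 2) (x : K) : ∃ a b : ℚ, x = a + b * α := by
  refine ⟨(basisOneSqrt hp hα hdeg).repr x 0, (basisOneSqrt hp hα hdeg).repr x 1, ?_⟩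
  conv_lhs => rw [← (basisOneSqrt hp hα hdeg).sum_repr x]
  simp [coe_basisOneSqrt, Algebra.smul_def]

theorem leftMulMatrix_basisOneSqrt (hp : p.Prime) (hα : α ^ 2 = p)
    (hdeg : Module.finrank ℚ K = 2) (a b : ℚ) :
    Algebra.leftMulMatrix (basisOneSqrt hp hα hdeg) (a + b * α) = !![a, b * p; b, a] := by
  set B := basisOneSqrt hp hα hdeg with hB
  have h0 : B 0 = 1 := by simp [hB, coe_basisOneSqrt]
  have h1 : B 1 = α := by simp [hB, coe_basisOneSqrt]
  have e0 : ((a : K) + b * α) * B 0 = a • B 0 + b • B 1 := by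
    simp [h0, h1, Algebra.smul_def]
  have e1 : ((a : K) + b * α) * B 1 = (b * p) • B 0 + a • B 1 := by
    simp only [h0, h1, Algebra.smul_def, eq_ratCast, Rat.cast_mul, Rat.cast_natCast, ← hα]
    ring
  ext i j
  fin_cases i <;> fin_cases j <;>
    simp [Algebra.leftMulMatrix_eq_repr_mul, e0, e1]

theorem trace_add_mul_sqrt (hp : p.Prime) (hα : α ^ 2 = p)
    (hdeg : Module.finrank ℚ K = 2) (a b : ℚ) :
    Algebra.trace ℚ K (a + b * α) = 2 * a := by
  rw [Algebra.trace_eq_matrix_trace (basisOneSqrt hp hα hdeg), leftMulMatrix_basisOneSqrt]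
  simp [Matrix.trace_fin_two, two_mul]

theorem norm_add_mul_sqrt (hp : p.Prime) (hα : α ^ 2 = p)
    (hdeg : Module.finrank ℚ K = 2) (a b : ℚ) :
    Algebra.norm ℚ (a + b * α : K) = a ^ 2 - p * b ^ 2 := by
  rw [Algebra.norm_eq_matrix_det (basisOneSqrt hp hα hdeg), leftMulMatrix_basisOneSqrt]
  rw [Matrix.det_fin_two]
  simp; ring

theorem exists_int_of_prime_mul_sq (hp : p.Prime) {y : ℚ} {k : ℤ} (h : p * y ^ 2 = k) :
    ∃ z : ℤ, y = z := by
  have hp0 : (p : ℚ) ≠ 0 := by exact_mod_cast hp.ne_zero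
  obtain ⟨z, hz⟩ : ∃ z : ℤ, (z : ℚ) = p * y := by
    refine IsIntegrallyClosed.algebraMap_eq_of_integral (R := ℤ) (K := ℚ) (x := p * y) ?_
    refine IsIntegral.of_pow two_pos ?_
    rw [show ((p : ℚ) * y) ^ 2 = algebraMap ℤ ℚ (p * k) by push_cast [← h]; simp [← h]; ring]
    exact isIntegral_algebraMap
  have h1 : z ^ 2 = p * k := by
    have : (z : ℚ) ^ 2 = p * k := by rw [hz, ← h]; ring
    exact_mod_cast this
  obtain ⟨w, rfl⟩ := (Nat.prime_iff_prime_int.1 hp).dvd_of_dvd_pow (Dvd.intro _ h1.symm)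
  refine ⟨w, ?_⟩
  push_cast at hz
  exact (mul_left_cancel₀ hp0 hz).symm

/-- The integer `(1 + α) / 2` of a quadratic field containing `α = √p`. -/
noncomputable def halfOneAddSqrt (hp4 : p % 4 = 1) (hα : α ^ 2 = p) : 𝓞 K :=
  ⟨(1 + α) / 2, by
    rw [mem_integralClosure_iff]
    refine ⟨Polynomial.X ^ 2 - (Polynomial.X + Polynomial.C ((p / 4 : ℕ) : ℤ)),
      Polynomial.monic_X_pow_sub (by compute_degree!), ?_⟩
    have h4 : (p : K) = 4 * (p / 4 : ℕ) + 1 := by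
      conv_lhs => rw [← Nat.div_add_mod p 4, hp4]
      push_cast; ring
    simp only [Polynomial.eval₂_sub, Polynomial.eval₂_add, Polynomial.eval₂_X_pow,
      Polynomial.eval₂_X, map_natCast, Polynomial.eval₂_natCast]
    rw [h4] at hα
    linear_combination hα / 4⟩

theorem coe_halfOneAddSqrt (hp4 : p % 4 = 1) (hα : α ^ 2 = p) :
    (halfOneAddSqrt hp4 hα : K) = (1 + α) / 2 := rfl

theorem halfOneAddSqrt_sq (hp4 : p % 4 = 1) (hα : α ^ 2 = p) :
    halfOneAddSqrt hp4 hα ^ 2 = halfOneAddSqrt hp4 hα + (p / 4 : ℕ) := by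
  apply RingOfIntegers.ext
  have h4 : (p : K) = 4 * (p / 4 : ℕ) + 1 := by
    conv_lhs => rw [← Nat.div_add_mod p 4, hp4]
    push_cast; ring
  rw [h4] at hα
  simp only [map_pow, map_add, map_natCast, coe_halfOneAddSqrt]
  linear_combination hα / 4

theorem exists_int_add_mul_halfOneAddSqrt (hp : p.Prime) (hp4 : p % 4 = 1) (hα : α ^ 2 = p)
    (hdeg : Module.finrank ℚ K = 2) (x : 𝓞 K) :
    ∃ u v : ℤ, x = u + v * halfOneAddSqrt hp4 hα := by
  obtain ⟨a, b, hx⟩ := exists_rat_add_mul_sqrt hp hα hdeg (x : K)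
  obtain ⟨m, hm⟩ : ∃ m : ℤ, (m : ℚ) = 2 * a := by
    rw [← trace_add_mul_sqrt hp hα hdeg a b, ← hx]
    exact IsIntegrallyClosed.algebraMap_eq_of_integral (R := ℤ)
      (Algebra.isIntegral_trace x.isIntegral_coe)
  obtain ⟨n, hn⟩ : ∃ n : ℤ, (n : ℚ) = a ^ 2 - p * b ^ 2 := by
    rw [← norm_add_mul_sqrt hp hα hdeg a b, ← hx]
    exact IsIntegrallyClosed.algebraMap_eq_of_integral (R := ℤ)
      (Algebra.isIntegral_norm ℚ x.isIntegral_coe)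
  obtain ⟨y, hy⟩ := exists_int_of_prime_mul_sq hp (y := 2 * b) (k := m ^ 2 - 4 * n) (by
    push_cast; rw [hm, hn]; ring)
  have h : m ^ 2 - p * y ^ 2 = 4 * n := by
    have : (m : ℚ) ^ 2 - p * y ^ 2 = 4 * n := by rw [hm, hn, ← hy]; ring
    exact_mod_cast this
  obtain ⟨u, hu⟩ : (2 : ℤ) ∣ m - y := by
    have hpe : (p : ℤ) % 2 = 1 := by omega
    have h2 : (m ^ 2 - p * y ^ 2) % 2 = 0 := by rw [h]; omega
    have h3 : Even (m ^ 2 - p * y ^ 2) := Int.even_iff.2 h2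
    have hpo : ¬ Even (p : ℤ) := by rw [Int.even_iff]; omega
    have : Even (m - y) := by
      simp only [Int.even_sub, Int.even_mul, Int.even_pow, hpo] at h3 ⊢
      simpa using h3
    exact this.two_dvd
  refine ⟨u, y, RingOfIntegers.ext ?_⟩
  simp only [map_add, map_mul, map_intCast, coe_halfOneAddSqrt]
  have h2a : (2 : K) * a = m := by exact_mod_cast congrArg (Rat.cast : ℚ → K) hm.symm
  have h2b : (2 : K) * b = y := by exact_mod_cast congrArg (Rat.cast : ℚ → K) hy
  have hu' : (m : K) - y = 2 * u := by exact_mod_cast congrArg (Int.cast : ℤ → K) hu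
  rw [hx]
  linear_combination (h2a + α * h2b + hu') / 2

theorem int_add_mul_halfOneAddSqrt_eq_zero (hp : p.Prime) (hp4 : p % 4 = 1) (hα : α ^ 2 = p)
    {u v : ℤ} (h : (u + v * halfOneAddSqrt hp4 hα : 𝓞 K) = 0) : u = 0 ∧ v = 0 := by
  have hcoe := congrArg (algebraMap (𝓞 K) K) h
  simp only [map_add, map_mul, map_intCast, coe_halfOneAddSqrt, map_zero] at hcoe
  have hv : v = 0 := by
    by_contra hv
    have hv' : (v : K) ≠ 0 := by exact_mod_cast hv
    refine algebraMap_rat_ne_of_sq_eq_prime hp hα (-(2 * u + v) / v) ?_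
    simp only [eq_ratCast, Rat.cast_div, Rat.cast_neg, Rat.cast_add, Rat.cast_mul,
      Rat.cast_ofNat, Rat.cast_intCast]
    field_simp
    linear_combination (-2) * hcoe
  subst hv
  simpa using hcoe

/-- The integral basis `1, (1 + √p) / 2` of `ℚ(√p)`. -/
noncomputable def intBasisOneHalf (hp : p.Prime) (hp4 : p % 4 = 1) (hα : α ^ 2 = p)
    (hdeg : Module.finrank ℚ K = 2) : Module.Basis (Fin 2) ℤ (𝓞 K) :=
  Module.Basis.mk (v := ![1, halfOneAddSqrt hp4 hα])
    (LinearIndependent.pair_iff.2 fun s t h ↦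
      int_add_mul_halfOneAddSqrt_eq_zero hp hp4 hα (by simpa using h))
    (fun x _ ↦ by
      obtain ⟨u, v, rfl⟩ := exists_int_add_mul_halfOneAddSqrt hp hp4 hα hdeg x
      rw [Matrix.range_cons, Matrix.range_cons, Matrix.range_empty, Set.union_empty,
        Set.singleton_union]
      exact Submodule.mem_span_pair.2 ⟨u, v, by simp⟩)

theorem coe_intBasisOneHalf (hp : p.Prime) (hp4 : p % 4 = 1) (hα : α ^ 2 = p)
    (hdeg : Module.finrank ℚ K = 2) :
    ⇑(intBasisOneHalf hp hp4 hα hdeg) = ![1, halfOneAddSqrt hp4 hα] :=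
  Module.Basis.coe_mk _ _

theorem discr_eq_of_sq_eq_prime (hp : p.Prime) (hp4 : p % 4 = 1) (hα : α ^ 2 = p)
    (hdeg : Module.finrank ℚ K = 2) : discr K = p := by
  rw [← discr_eq_discr K (intBasisOneHalf hp hp4 hα hdeg), Algebra.discr_def,
    Matrix.det_fin_two]
  have ht (x : 𝓞 K) (a b : ℚ) (hx : (x : K) = a + b * α) :
      (Algebra.trace ℤ (𝓞 K) x : ℚ) = 2 * a := by
    rw [← trace_add_mul_sqrt hp hα hdeg a b, ← hx]
    exact Algebra.coe_trace_int x
  have h1 : (Algebra.trace ℤ (𝓞 K) 1 : ℚ) = 2 := by rw [ht 1 1 0 (by simp)]; norm_num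
  have h2 : (Algebra.trace ℤ (𝓞 K) (halfOneAddSqrt hp4 hα) : ℚ) = 1 := by
    rw [ht _ (1 / 2) (1 / 2) (by rw [coe_halfOneAddSqrt]; push_cast; ring)]; norm_num
  have h3 : (Algebra.trace ℤ (𝓞 K) (halfOneAddSqrt hp4 hα * halfOneAddSqrt hp4 hα) : ℚ) =
      (1 + p) / 2 := by
    rw [ht _ ((1 + p) / 4) (1 / 2) (by
      change (1 + α) / 2 * ((1 + α) / 2) = _
      push_cast
      linear_combination hα / 4)]
    ring
  simp only [Algebra.traceMatrix_apply, Algebra.traceForm_apply, coe_intBasisOneHalf,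
    Matrix.cons_val_zero, Matrix.cons_val_one, one_mul, mul_one]
  have : ((Algebra.trace ℤ (𝓞 K) 1 *
      Algebra.trace ℤ (𝓞 K) (halfOneAddSqrt hp4 hα * halfOneAddSqrt hp4 hα) -
      Algebra.trace ℤ (𝓞 K) (halfOneAddSqrt hp4 hα) *
        Algebra.trace ℤ (𝓞 K) (halfOneAddSqrt hp4 hα) : ℤ) : ℚ) = p := by
    push_cast
    rw [h1, h2, h3]; ring
  exact_mod_cast this

open scoped Classical in
theorem isTotallyReal_of_sq_eq_prime (hp : p.Prime) (hα : α ^ 2 = p)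
    (hdeg : Module.finrank ℚ K = 2) : IsTotallyReal K := by
  have hreal (φ : K →+* ℂ) : ComplexEmbedding.IsReal φ := by
    have hφ : (φ α) ^ 2 = ((√p : ℝ) : ℂ) ^ 2 := by
      rw [← map_pow, hα, map_natCast, ← Complex.ofReal_pow, Real.sq_sqrt (Nat.cast_nonneg _),
        Complex.ofReal_natCast]
    have hc : (starRingEnd ℂ) (φ α) = φ α := by
      rcases sq_eq_sq_iff_eq_or_eq_neg.1 hφ with h | h <;> simp [h]
    rw [ComplexEmbedding.isReal_iff]
    ext x
    obtain ⟨a, b, rfl⟩ := exists_rat_add_mul_sqrt hp hα hdeg x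
    simp [hc]
  refine ⟨fun w ↦ ?_⟩
  rw [InfinitePlace.isReal_iff]
  exact hreal _

theorem torsionOrder_eq_two_of_isTotallyReal (K : Type*) [Field K] [NumberField K]
    [IsTotallyReal K] : Units.torsionOrder K = 2 := by
  have hpos : 0 < InfinitePlace.nrRealPlaces K := by
    rw [← IsTotallyReal.finrank]; exact Module.finrank_pos
  have key (x : Units.torsion K) : (x : (𝓞 K)ˣ) = 1 ∨ (x : (𝓞 K)ˣ) = -1 := by
    by_cases! hc : 2 < orderOf (x : (𝓞 K)ˣ)
    · have h := ((IsPrimitiveRoot.orderOf (x : (𝓞 K)ˣ)).map_of_injective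
        (f := Units.coeHom (𝓞 K)) Units.val_injective).map_of_injective
        (f := algebraMap (𝓞 K) K) RingOfIntegers.coe_injective
      have := InfinitePlace.IsPrimitiveRoot.nrRealPlaces_eq_zero_of_two_lt hc h
      omega
    · interval_cases hi : orderOf (x : (𝓞 K)ˣ)
      · have := orderOf_pos_iff.2 ((CommGroup.mem_torsion x.1).1 x.2)
        omega
      · exact Or.inl (orderOf_eq_one_iff.1 hi)
      · rw [← orderOf_units, CharP.orderOf_eq_two_iff 0 (by decide)] at hi
        right
        ext
        simp [hi]
  refine le_antisymm ?_ (Nat.le_of_dvd (Units.torsionOrder_pos K)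
    (even_iff_two_dvd.1 (Units.even_torsionOrder K)))
  have hsub : (Units.torsion K : Set (𝓞 K)ˣ) ⊆ {1, -1} := fun x hx ↦ key ⟨x, hx⟩
  exact (Set.ncard_le_ncard hsub (Set.toFinite _)).trans (Set.ncard_pair (by
    rw [Ne, Units.ext_iff]
    simp [eq_neg_iff_add_eq_zero, one_add_one_eq_two])).le

open scoped Classical in
theorem regulator_eq_abs_log_of_finrank_eq_two [IsTotallyReal K]
    (hdeg : Module.finrank ℚ K = 2) (ε : (𝓞 K)ˣ)
    (hfund : ∀ u : (𝓞 K)ˣ, ∃ n : ℤ, u = ε ^ n ∨ u = -ε ^ n) (w : InfinitePlace K) :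
    Units.regulator K = |Real.log (w (ε : K))| := by
  have hcard : Fintype.card (InfinitePlace K) = 2 := by
    rw [InfinitePlace.card_eq_nrRealPlaces_add_nrComplexPlaces,
      IsTotallyReal.nrComplexPlaces_eq_zero, ← IsTotallyReal.finrank, hdeg]
  have hrank : Units.rank K = 1 := by rw [Units.rank, hcard]
  obtain ⟨w', hw'⟩ := Fintype.exists_ne_of_one_lt_card (by omega : 1 < Fintype.card _) w
  have hc : Fintype.card {v // v ≠ w'} = 1 := by
    rw [Fintype.card_subtype_compl, hcard, Fintype.card_subtype_eq]
  have hsub : Subsingleton {v // v ≠ w'} := Fintype.card_le_one_iff_subsingleton.1 hc.le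
  have e : {v // v ≠ w'} ≃ Fin (Units.rank K) :=
    Fintype.equivFinOfCardEq (by rw [hc, hrank])
  have hi := Units.regOfFamily_div_regulator (K := K) fun _ ↦ ε
  have htop :
      Subgroup.closure (Set.range fun _ : Fin (Units.rank K) ↦ ε) ⊔ Units.torsion K = ⊤ := by
    refine eq_top_iff.2 fun u _ ↦ ?_
    have hε : ε ∈ Subgroup.closure (Set.range fun _ : Fin (Units.rank K) ↦ ε) :=
      Subgroup.subset_closure ⟨⟨0, by omega⟩, rfl⟩
    obtain ⟨n, rfl | rfl⟩ := hfund u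
    · exact Subgroup.mem_sup_left (zpow_mem hε n)
    · rw [← mul_neg_one]
      exact Subgroup.mul_mem_sup (zpow_mem hε n)
        ((CommGroup.mem_torsion (-1 : (𝓞 K)ˣ)).2 (isOfFinOrder_iff_pow_eq_one.2 ⟨2, by simp⟩))
  rw [htop, Subgroup.index_top, Nat.cast_one, div_eq_one_iff_eq (Units.regulator_ne_zero K)] at hi
  rw [← hi, Units.regOfFamily_eq_det _ w' e,
    Matrix.det_eq_elem_of_subsingleton _ ⟨w, hw'.symm⟩]
  simp [IsTotallyReal.mult_eq]

theorem dedekindZeta_residue_mul_sqrt (hp : p.Prime) (hp4 : p % 4 = 1) (hα : α ^ 2 = p)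
    (hdeg : Module.finrank ℚ K = 2) :
    dedekindZeta_residue K * √p = 2 * classNumber K * Units.regulator K := by
  have := isTotallyReal_of_sq_eq_prime hp hα hdeg
  have hs : √(p : ℝ) ≠ 0 := Real.sqrt_ne_zero'.2 (by exact_mod_cast hp.pos)
  rw [dedekindZeta_residue_def, discr_eq_of_sq_eq_prime hp hp4 hα hdeg,
    torsionOrder_eq_two_of_isTotallyReal, ← IsTotallyReal.finrank, hdeg,
    IsTotallyReal.nrComplexPlaces_eq_zero, Int.cast_natCast, Nat.abs_cast]
  push_cast
  field_simp

end RealQuadraticField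

section IdealCount

variable (K : Type*) [Field K] [NumberField K]

/-- The number of ideals of `𝓞 K` of norm `n`, as an arithmetic function. -/
noncomputable def idealCount : ArithmeticFunction ℂ :=
  toArithmeticFunction fun n ↦ (Nat.card {I : Ideal (𝓞 K) // Ideal.absNorm I = n} : ℂ)

variable {K}

theorem idealCount_apply {n : ℕ} (hn : n ≠ 0) :
    idealCount K n = Nat.card {I : Ideal (𝓞 K) // Ideal.absNorm I = n} := by
  simp [idealCount, toArithmeticFunction, hn]

theorem dvd_span_natCast_of_absNorm_eq {I : Ideal (𝓞 K)} {n : ℕ} (h : Ideal.absNorm I = n) :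
    I ∣ Ideal.span {(n : 𝓞 K)} := by
  rw [Ideal.dvd_iff_le, ← h]
  exact Ideal.span_singleton_absNorm_le I

theorem span_natCast_sup_span_natCast {R : Type*} [CommRing R] {m n : ℕ} (h : m.Coprime n) :
    Ideal.span {(m : R)} ⊔ Ideal.span {(n : R)} = ⊤ := by
  rw [← Ideal.isCoprime_iff_sup_eq, Ideal.isCoprime_span_singleton_iff]
  exact Nat.Coprime.cast h

theorem mul_sup_span_eq_left {I J : Ideal (𝓞 K)} {m n : ℕ} (h : m.Coprime n)
    (hI : Ideal.absNorm I = m) (hJ : Ideal.absNorm J = n) :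
    I * J ⊔ Ideal.span {(m : 𝓞 K)} = I := by
  have hmI := Ideal.le_of_dvd (dvd_span_natCast_of_absNorm_eq hI)
  have hnJ := Ideal.le_of_dvd (dvd_span_natCast_of_absNorm_eq hJ)
  refine le_antisymm (sup_le Ideal.mul_le_left hmI) ?_
  have htop : J ⊔ Ideal.span {(m : 𝓞 K)} = ⊤ := by
    refine eq_top_iff.2 ?_
    rw [← span_natCast_sup_span_natCast h, sup_comm]
    exact sup_le_sup_right hnJ _
  calc I = I * (J ⊔ Ideal.span {(m : 𝓞 K)}) := by rw [htop, Ideal.mul_top]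
    _ = I * J ⊔ I * Ideal.span {(m : 𝓞 K)} := Ideal.mul_sup _ _ _
    _ ≤ _ := sup_le_sup_left Ideal.mul_le_right _

theorem sup_span_mul_sup_span_eq {I : Ideal (𝓞 K)} {m n : ℕ} (h : m.Coprime n)
    (hI : Ideal.absNorm I = m * n) :
    (I ⊔ Ideal.span {(m : 𝓞 K)}) * (I ⊔ Ideal.span {(n : 𝓞 K)}) = I := by
  have hmn := Ideal.le_of_dvd (dvd_span_natCast_of_absNorm_eq hI)
  rw [Nat.cast_mul, ← Ideal.span_singleton_mul_span_singleton] at hmn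
  refine le_antisymm ?_ ?_
  · rw [Ideal.sup_mul, Ideal.mul_sup]
    refine sup_le (sup_le Ideal.mul_le_left Ideal.mul_le_left) ?_
    rw [Ideal.mul_sup]
    exact sup_le Ideal.mul_le_right hmn
  · calc I = I * (Ideal.span {(m : 𝓞 K)} ⊔ Ideal.span {(n : 𝓞 K)}) := by
          rw [span_natCast_sup_span_natCast h, Ideal.mul_top]
      _ = I * Ideal.span {(m : 𝓞 K)} ⊔ I * Ideal.span {(n : 𝓞 K)} := Ideal.mul_sup _ _ _
      _ ≤ _ := sup_le (by rw [mul_comm]; exact Ideal.mul_mono le_sup_right le_sup_left)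
          (Ideal.mul_mono le_sup_left le_sup_right)

theorem absNorm_sup_span_coprime {I : Ideal (𝓞 K)} {m n : ℕ} (h : m.Coprime n) :
    (Ideal.absNorm (I ⊔ Ideal.span {(m : 𝓞 K)})).Coprime n := by
  have h1 : Ideal.absNorm (I ⊔ Ideal.span {(m : 𝓞 K)}) ∣ m ^ Module.finrank ℤ (𝓞 K) := by
    rw [← Ideal.absNorm_span_natCast]
    exact Ideal.absNorm_dvd_absNorm_of_le le_sup_right
  exact (h.pow_left _).coprime_dvd_left h1

theorem absNorm_sup_span_eq {I : Ideal (𝓞 K)} {m n : ℕ} (h : m.Coprime n)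
    (hI : Ideal.absNorm I = m * n) :
    Ideal.absNorm (I ⊔ Ideal.span {(m : 𝓞 K)}) = m ∧
      Ideal.absNorm (I ⊔ Ideal.span {(n : 𝓞 K)}) = n := by
  have hmul : Ideal.absNorm (I ⊔ Ideal.span {(m : 𝓞 K)}) *
      Ideal.absNorm (I ⊔ Ideal.span {(n : 𝓞 K)}) = m * n := by
    rw [← map_mul, sup_span_mul_sup_span_eq h hI, hI]
  have hA := absNorm_sup_span_coprime (I := I) h
  have hB := absNorm_sup_span_coprime (I := I) h.symm
  exact ⟨Nat.dvd_antisymm (hA.dvd_of_dvd_mul_right (Dvd.intro _ hmul))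
      (hB.symm.dvd_of_dvd_mul_right (Dvd.intro _ hmul.symm)),
    Nat.dvd_antisymm (hB.dvd_of_dvd_mul_left (Dvd.intro_left _ hmul))
      (hA.symm.dvd_of_dvd_mul_left (Dvd.intro_left _ hmul.symm))⟩

/-- Ideals of coprime norms multiply freely. -/
def idealsOfCoprimeNormEquiv {m n : ℕ} (h : m.Coprime n) :
    {I : Ideal (𝓞 K) // Ideal.absNorm I = m} × {I : Ideal (𝓞 K) // Ideal.absNorm I = n} ≃
      {I : Ideal (𝓞 K) // Ideal.absNorm I = m * n} where
  toFun x := ⟨x.1 * x.2, by rw [map_mul, x.1.2, x.2.2]⟩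
  invFun x := (⟨x.1 ⊔ Ideal.span {(m : 𝓞 K)}, (absNorm_sup_span_eq h x.2).1⟩,
    ⟨x.1 ⊔ Ideal.span {(n : 𝓞 K)}, (absNorm_sup_span_eq h x.2).2⟩)
  left_inv x := by
    ext1
    · exact Subtype.ext (mul_sup_span_eq_left h x.1.2 x.2.2)
    · refine Subtype.ext ?_
      simp only [mul_comm x.1.1]
      exact mul_sup_span_eq_left h.symm x.2.2 x.1.2
  right_inv x := Subtype.ext (sup_span_mul_sup_span_eq h x.2)

variable (K) in
theorem isMultiplicative_idealCount : (idealCount K).IsMultiplicative := by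
  rw [ArithmeticFunction.IsMultiplicative.iff_ne_zero]
  refine ⟨?_, fun {m n} hm hn h ↦ ?_⟩
  · rw [idealCount_apply one_ne_zero]
    simp [Ideal.absNorm_eq_one_iff]
  · rw [idealCount_apply hm, idealCount_apply hn, idealCount_apply (mul_ne_zero hm hn),
      ← Nat.card_congr (idealsOfCoprimeNormEquiv h), Nat.card_prod, Nat.cast_mul]

theorem card_absNorm_eq_pow_of_inert {P : Ideal (𝓞 K)} (hP : Prime P) {l : ℕ} (hl : l.Prime)
    (hlP : Ideal.span {(l : 𝓞 K)} = P) (hN : Ideal.absNorm P = l ^ 2) (k : ℕ) :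
    Nat.card {I : Ideal (𝓞 K) // Ideal.absNorm I = l ^ k} = if Even k then 1 else 0 := by
  have hform {I : Ideal (𝓞 K)} (hI : Ideal.absNorm I = l ^ k) : ∃ i, I = P ^ i ∧ 2 * i = k := by
    have := dvd_span_natCast_of_absNorm_eq hI
    rw [Nat.cast_pow, ← Ideal.span_singleton_pow, hlP] at this
    obtain ⟨i, -, hi⟩ := (dvd_prime_pow hP _).1 this
    rw [associated_iff_eq] at hi
    refine ⟨i, hi, ?_⟩
    rw [hi, map_pow, hN, ← pow_mul] at hI
    exact Nat.pow_right_injective hl.two_le hI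
  split_ifs with hk
  · obtain ⟨j, rfl⟩ := hk
    rw [Nat.card_eq_one_iff_unique]
    refine ⟨⟨fun I J ↦ Subtype.ext ?_⟩, ⟨⟨P ^ j, by rw [map_pow, hN, ← pow_mul, two_mul]⟩⟩⟩
    obtain ⟨i, hi, hi'⟩ := hform I.2
    obtain ⟨i₂, hi₂, hi₂'⟩ := hform J.2
    rw [hi, hi₂, show i = i₂ by omega]
  · rw [Nat.card_eq_zero]
    refine Or.inl ⟨fun I ↦ hk ?_⟩
    obtain ⟨i, -, rfl⟩ := hform I.2
    exact even_two_mul i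

theorem card_absNorm_eq_pow_of_ramified {P : Ideal (𝓞 K)} (hP : Prime P) {l : ℕ} (hl : l.Prime)
    (hlP : Ideal.span {(l : 𝓞 K)} = P ^ 2) (hN : Ideal.absNorm P = l) (k : ℕ) :
    Nat.card {I : Ideal (𝓞 K) // Ideal.absNorm I = l ^ k} = 1 := by
  have hform {I : Ideal (𝓞 K)} (hI : Ideal.absNorm I = l ^ k) : I = P ^ k := by
    have := dvd_span_natCast_of_absNorm_eq hI
    rw [Nat.cast_pow, ← Ideal.span_singleton_pow, hlP, ← pow_mul] at this
    obtain ⟨i, -, hi⟩ := (dvd_prime_pow hP _).1 this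
    rw [associated_iff_eq] at hi
    rw [hi, map_pow, hN] at hI
    rw [hi, Nat.pow_right_injective hl.two_le hI]
  rw [Nat.card_eq_one_iff_unique]
  exact ⟨⟨fun I J ↦ Subtype.ext ((hform I.2).trans (hform J.2).symm)⟩,
    ⟨⟨P ^ k, by rw [map_pow, hN]⟩⟩⟩

theorem card_absNorm_eq_pow_of_split {P Q : Ideal (𝓞 K)} (hP : Prime P) (hQ : Prime Q)
    (hPQ : P ≠ Q) {l : ℕ} (hl : l.Prime) (hlPQ : Ideal.span {(l : 𝓞 K)} = P * Q)
    (hNP : Ideal.absNorm P = l) (hNQ : Ideal.absNorm Q = l) (k : ℕ) :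
    Nat.card {I : Ideal (𝓞 K) // Ideal.absNorm I = l ^ k} = k + 1 := by
  have hnorm (i j : ℕ) : Ideal.absNorm (P ^ i * Q ^ j) = l ^ (i + j) := by
    rw [map_mul, map_pow, map_pow, hNP, hNQ, pow_add]
  have hndvd (i : ℕ) : ¬ P ∣ Q ^ i := fun h ↦
    hPQ (associated_iff_eq.1 (hP.associated_of_dvd hQ (hP.dvd_of_dvd_pow h)))
  have hinj {i j i' j' : ℕ} (h : P ^ i * Q ^ j = P ^ i' * Q ^ j') : i = i' := by
    have hm (a b : ℕ) : emultiplicity P (P ^ a * Q ^ b) = a := by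
      rw [emultiplicity_mul hP, emultiplicity_eq_zero.2 (hndvd b), add_zero,
        emultiplicity_pow_self hP.ne_zero hP.not_isUnit]
    have := (hm i j).symm.trans ((congrArg _ h).trans (hm i' j'))
    exact_mod_cast this
  have hset : {I : Ideal (𝓞 K) | Ideal.absNorm I = l ^ k} =
      ((Finset.range (k + 1)).image fun i ↦ P ^ i * Q ^ (k - i) : Finset (Ideal (𝓞 K))) := by
    ext I
    simp only [Set.mem_ofPred_eq, Finset.coe_image, Finset.coe_range, Set.mem_image, Set.mem_Iio]
    constructor
    · intro hI
      have := dvd_span_natCast_of_absNorm_eq hI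
      rw [Nat.cast_pow, ← Ideal.span_singleton_pow, hlPQ, mul_pow] at this
      obtain ⟨A, B, hA, hB, rfl⟩ := exists_dvd_and_dvd_of_dvd_mul this
      obtain ⟨i, -, hi⟩ := (dvd_prime_pow hP _).1 hA
      obtain ⟨j, -, hj⟩ := (dvd_prime_pow hQ _).1 hB
      rw [associated_iff_eq] at hi hj
      subst hi hj
      rw [hnorm] at hI
      have := Nat.pow_right_injective hl.two_le hI
      exact ⟨i, by omega, by rw [← this, Nat.add_sub_cancel_left]⟩
    · rintro ⟨i, hi, rfl⟩
      rw [hnorm, Nat.add_sub_cancel' (by omega)]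
  change Nat.card ({I : Ideal (𝓞 K) | Ideal.absNorm I = l ^ k} : Set (Ideal (𝓞 K))) = _
  rw [Nat.card_coe_set_eq, hset, Set.ncard_coe_finset, Finset.card_image_of_injective,
    Finset.card_range]
  exact fun i j h ↦ hinj h

end IdealCount

section QuadraticIdealCount

variable {p : ℕ} {K : Type*} [Field K] [NumberField K] {α : K}

theorem two_mul_halfOneAddSqrt_sub_one_sq (hp4 : p % 4 = 1) (hα : α ^ 2 = p) :
    (2 * halfOneAddSqrt hp4 hα - 1) ^ 2 = (p : 𝓞 K) := by
  have h4 : (p : 𝓞 K) = 4 * (p / 4 : ℕ) + 1 := by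
    conv_lhs => rw [← Nat.div_add_mod p 4, hp4]
    push_cast; ring
  linear_combination 4 * halfOneAddSqrt_sq hp4 hα - h4

theorem not_isSquare_two_zmod [Fact p.Prime] (hp8 : p % 8 = 5) : ¬ IsSquare (2 : ZMod p) := by
  rw [ZMod.exists_sq_eq_two_iff (by omega)]
  omega

/-- A prime that is not a square modulo `p ≡ 5 (mod 8)` is not the norm of an ideal of
`ℚ(√p)`. -/
theorem absNorm_ne_of_not_isSquare [Fact p.Prime] (hp8 : p % 8 = 5) (hα : α ^ 2 = p)
    {l : ℕ} (hl : l.Prime) (hsq : ¬ IsSquare (l : ZMod p)) (I : Ideal (𝓞 K)) :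
    Ideal.absNorm I ≠ l := by
  intro hI
  have hdec : ∀ x : ZMod 2, x ^ 2 ≠ x + 1 := by decide
  have hp4 : p % 4 = 1 := by omega
  have := Fact.mk hl
  have : Finite (𝓞 K ⧸ I) := (Ideal.absNorm_ne_zero_iff I).1 (hI ▸ hl.ne_zero)
  have := Fintype.ofFinite (𝓞 K ⧸ I)
  have hcard : Fintype.card (𝓞 K ⧸ I) = l := by
    rw [← Nat.card_eq_fintype_card, ← hI, Ideal.absNorm_apply, Submodule.cardQuot_apply]
  let φ : 𝓞 K →+* ZMod l :=
    (ZMod.ringEquivOfPrime (𝓞 K ⧸ I) hl hcard).symm.toRingHom.comp (Ideal.Quotient.mk I)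
  rcases eq_or_ne l 2 with rfl | hl2
  · have h := congrArg φ (halfOneAddSqrt_sq hp4 hα)
    rw [map_pow, map_add, map_natCast] at h
    have h1 : ((p / 4 : ℕ) : ZMod 2) = 1 := by
      rw [ZMod.natCast_eq_one_iff_odd, Nat.odd_iff]; omega
    rw [h1] at h
    exact hdec _ h
  · have h := congrArg φ (two_mul_halfOneAddSqrt_sub_one_sq hp4 hα)
    rw [map_pow, map_natCast] at h
    refine hsq ((ZMod.exists_sq_eq_prime_iff_of_mod_four_eq_one hp4 hl2).2
      ⟨φ (2 * halfOneAddSqrt hp4 hα - 1), ?_⟩)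
    rw [← h, sq]

theorem absNorm_span_natCast_of_finrank_eq_two (hdeg : Module.finrank ℚ K = 2) (n : ℕ) :
    Ideal.absNorm (Ideal.span {(n : 𝓞 K)}) = n ^ 2 := by
  rw [Ideal.absNorm_span_natCast, RingOfIntegers.rank, hdeg]

theorem prime_span_of_not_isSquare [Fact p.Prime] (hp8 : p % 8 = 5) (hα : α ^ 2 = p)
    (hdeg : Module.finrank ℚ K = 2) {l : ℕ} (hl : l.Prime) (hsq : ¬ IsSquare (l : ZMod p)) :
    Prime (Ideal.span {(l : 𝓞 K)}) := by
  have hN := absNorm_span_natCast_of_finrank_eq_two hdeg l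
  have h0 : Ideal.span {(l : 𝓞 K)} ≠ ⊥ := by
    rw [Ne, Ideal.span_singleton_eq_bot]
    exact_mod_cast hl.ne_zero
  have htop : Ideal.span {(l : 𝓞 K)} ≠ ⊤ := by
    intro h
    rw [h, Ideal.absNorm_top] at hN
    have := hl.two_le
    nlinarith
  obtain ⟨M, hM, hle⟩ := Ideal.exists_le_maximal _ htop
  obtain ⟨J, hJ⟩ := Ideal.dvd_iff_le.2 hle
  have hmul : Ideal.absNorm M * Ideal.absNorm J = l ^ 2 := by rw [← map_mul, ← hJ, hN]
  obtain ⟨i, hi, hMi⟩ := (Nat.dvd_prime_pow hl).1 (Dvd.intro _ hmul)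
  have hi2 : i = 2 := by
    interval_cases i
    · exact absurd (Ideal.absNorm_eq_one_iff.1 (by simpa using hMi)) hM.ne_top
    · exact absurd (by simpa using hMi) (absNorm_ne_of_not_isSquare hp8 hα hl hsq M)
    · rfl
  rw [hMi, hi2] at hmul
  have hJ1 : J = ⊤ := Ideal.absNorm_eq_one_iff.1
    (Nat.eq_of_mul_eq_mul_left (pow_pos hl.pos 2) (by rw [hmul, mul_one]))
  rw [hJ1, Ideal.mul_top] at hJ
  rw [hJ] at h0 ⊢
  exact Ideal.prime_of_isPrime h0 hM.isPrime

theorem span_sup_span_eq_top_of_two_mul {R : Type*} [CommRing R] {l : ℕ} (hl : l.Prime)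
    (hl2 : l ≠ 2) {x : ℕ} (hx : ¬ l ∣ x) {I : Ideal R} (h1 : (l : R) ∈ I)
    (h2 : (2 * x : R) ∈ I) : I = ⊤ := by
  have hc : l.Coprime (2 * x) := by
    refine (hl.coprime_iff_not_dvd).2 fun h ↦ ?_
    rcases hl.dvd_mul.1 h with h | h
    · exact hl2 ((Nat.prime_dvd_prime_iff_eq hl Nat.prime_two).1 h)
    · exact hx h
  refine eq_top_iff.2 ?_
  rw [← span_natCast_sup_span_natCast hc]
  refine sup_le ((Ideal.span_singleton_le_iff_mem _).2 h1)
    ((Ideal.span_singleton_le_iff_mem _).2 ?_)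
  push_cast
  exact h2

theorem exists_prime_mul_prime_of_isSquare [Fact p.Prime] (hp4 : p % 4 = 1) (hα : α ^ 2 = p)
    (hdeg : Module.finrank ℚ K = 2) {l : ℕ} (hl : l.Prime) (hl2 : l ≠ 2) (hlp : l ≠ p)
    (hsq : IsSquare (l : ZMod p)) :
    ∃ P Q : Ideal (𝓞 K), P ≠ Q ∧ Ideal.span {(l : 𝓞 K)} = P * Q ∧
      Ideal.absNorm P = l ∧ Ideal.absNorm Q = l := by
  have hp : p.Prime := Fact.out
  have := Fact.mk hl
  obtain ⟨y, hy⟩ := (ZMod.exists_sq_eq_prime_iff_of_mod_four_eq_one hp4 hl2).1 hsq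
  obtain ⟨x, rfl⟩ := ZMod.natCast_zmod_surjective y
  have hdvd : (l : ℤ) ∣ p - x ^ 2 := by
    rw [← ZMod.intCast_zmod_eq_zero_iff_dvd]
    push_cast
    rw [hy]; ring
  have hx : ¬ l ∣ x := by
    intro h
    have : (l : ℤ) ∣ p := by
      have h2 : (l : ℤ) ∣ (x : ℤ) ^ 2 := Dvd.dvd.pow (Int.natCast_dvd_natCast.2 h) two_ne_zero
      simpa using dvd_add hdvd h2
    exact hlp ((Nat.prime_dvd_prime_iff_eq hl hp).1 (Int.natCast_dvd_natCast.1 this))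
  obtain ⟨c, hc⟩ := hdvd
  set A : 𝓞 K := 2 * halfOneAddSqrt hp4 hα - 1 with hA
  have hA2 : A ^ 2 = p := two_mul_halfOneAddSqrt_sub_one_sq hp4 hα
  have hcA : (A - x) * (A + x) = l * c := by
    have : (p : 𝓞 K) - x ^ 2 = l * c := by exact_mod_cast congrArg (Int.cast : ℤ → 𝓞 K) hc
    rw [← this, ← hA2]; ring
  set P : Ideal (𝓞 K) := Ideal.span {(l : 𝓞 K), A - x} with hP
  set Q : Ideal (𝓞 K) := Ideal.span {(l : 𝓞 K), A + x} with hQ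
  have hlP : (l : 𝓞 K) ∈ P := Ideal.subset_span (by simp)
  have hlQ : (l : 𝓞 K) ∈ Q := Ideal.subset_span (by simp)
  have hxP : A - x ∈ P := Ideal.subset_span (by simp)
  have hxQ : A + x ∈ Q := Ideal.subset_span (by simp)
  have hPQ : Ideal.span {(l : 𝓞 K)} = P * Q := by
    refine le_antisymm ?_ ?_
    · have htop : P ⊔ Q = ⊤ := by
        refine span_sup_span_eq_top_of_two_mul hl hl2 hx (Ideal.mem_sup_left hlP) ?_
        rw [show (2 * x : 𝓞 K) = (A + x) - (A - x) by ring]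
        exact sub_mem (Ideal.mem_sup_right hxQ) (Ideal.mem_sup_left hxP)
      calc Ideal.span {(l : 𝓞 K)} = Ideal.span {(l : 𝓞 K)} * (P ⊔ Q) := by
            rw [htop, Ideal.mul_top]
        _ = Ideal.span {(l : 𝓞 K)} * P ⊔ Ideal.span {(l : 𝓞 K)} * Q := Ideal.mul_sup _ _ _
        _ ≤ P * Q := sup_le
          (by
            rw [mul_comm]
            exact Ideal.mul_mono le_rfl ((Ideal.span_singleton_le_iff_mem _).2 hlQ))
          (Ideal.mul_mono ((Ideal.span_singleton_le_iff_mem _).2 hlP) le_rfl)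
    · rw [hP, hQ, Ideal.span_pair_mul_span_pair, Ideal.span_le]
      rintro z (rfl | rfl | rfl | rfl) <;> rw [SetLike.mem_coe, Ideal.mem_span_singleton]
      · exact Dvd.intro _ rfl
      · exact Dvd.intro _ rfl
      · exact Dvd.intro_left _ rfl
      · exact Dvd.intro _ hcA.symm
  have hnot (n : ℤ) : 2 * halfOneAddSqrt hp4 hα + n ∉ Ideal.span {(l : 𝓞 K)} := by
    rw [Ideal.mem_span_singleton]
    rintro ⟨z, hz⟩
    obtain ⟨u, v, rfl⟩ := exists_int_add_mul_halfOneAddSqrt hp hp4 hα hdeg z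
    have h := (int_add_mul_halfOneAddSqrt_eq_zero hp hp4 hα (u := l * u - n) (v := l * v - 2) (by
      push_cast; linear_combination -hz)).2
    have h2 : (l : ℤ) ∣ (2 : ℕ) := ⟨v, by push_cast; linarith⟩
    exact hl2 ((Nat.prime_dvd_prime_iff_eq hl Nat.prime_two).1 (Int.natCast_dvd_natCast.1 h2))
  have hPtop : P ≠ ⊤ := by
    intro h
    rw [h, Ideal.top_mul] at hPQ
    refine hnot (x - 1) ?_
    rw [hPQ]
    convert! hxQ using 1
    rw [hA]; push_cast; ring
  have hQtop : Q ≠ ⊤ := by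
    intro h
    rw [h, Ideal.mul_top] at hPQ
    refine hnot (-x - 1) ?_
    rw [hPQ]
    convert! hxP using 1
    rw [hA]; push_cast; ring
  have hmul : Ideal.absNorm P * Ideal.absNorm Q = l ^ 2 := by
    rw [← map_mul, ← hPQ, absNorm_span_natCast_of_finrank_eq_two hdeg]
  have hN := (Nat.Prime.mul_eq_prime_sq_iff hl (fun h ↦ hPtop (Ideal.absNorm_eq_one_iff.1 h))
    (fun h ↦ hQtop (Ideal.absNorm_eq_one_iff.1 h))).1 hmul
  refine ⟨P, Q, fun h ↦ hPtop ?_, hPQ, hN⟩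
  refine span_sup_span_eq_top_of_two_mul hl hl2 hx hlP ?_
  rw [show (2 * x : 𝓞 K) = (A + x) - (A - x) by ring]
  exact sub_mem (h ▸ hxQ) hxP

theorem prime_of_prime_absNorm {P : Ideal (𝓞 K)} (h : (Ideal.absNorm P).Prime) : Prime P := by
  refine Ideal.prime_of_isPrime ?_ (Ideal.isPrime_of_irreducible_absNorm h)
  rintro rfl
  rw [Ideal.absNorm_bot] at h
  exact Nat.not_prime_zero h

theorem idealCount_prime_pow [Fact p.Prime] (hp8 : p % 8 = 5) (hα : α ^ 2 = p)
    (hdeg : Module.finrank ℚ K = 2) {l : ℕ} (hl : l.Prime) (k : ℕ) :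
    idealCount K (l ^ k) = ∑ i ∈ Finset.range (k + 1), quadraticCharTo p ℂ l ^ i := by
  have hp : p.Prime := Fact.out
  have hp4 : p % 4 = 1 := by omega
  have hchar := ringChar_zmod_ne_two hp4
  rw [idealCount_apply (pow_ne_zero _ hl.ne_zero), quadraticCharTo_apply]
  rcases eq_or_ne l p with rfl | hlp
  · have hsq : Ideal.span {(l : 𝓞 K)} =
        Ideal.span {(2 * halfOneAddSqrt hp4 hα - 1 : 𝓞 K)} ^ 2 := by
      rw [Ideal.span_singleton_pow, two_mul_halfOneAddSqrt_sub_one_sq]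
    have hN : Ideal.absNorm (Ideal.span {(2 * halfOneAddSqrt hp4 hα - 1 : 𝓞 K)}) = l := by
      have := absNorm_span_natCast_of_finrank_eq_two hdeg l
      rw [hsq, map_pow] at this
      exact Nat.pow_left_injective two_ne_zero this
    rw [card_absNorm_eq_pow_of_ramified (prime_of_prime_absNorm (by rwa [hN])) hl hsq hN,
      Finset.sum_range_succ', Finset.sum_eq_zero]
    · simp
    · simp
  have hl0 : (l : ZMod p) ≠ 0 := by
    rw [Ne, ZMod.natCast_eq_zero_iff, Nat.prime_dvd_prime_iff_eq hp hl]
    exact hlp.symm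
  by_cases hsq : IsSquare (l : ZMod p)
  · have hl2 : l ≠ 2 := by
      rintro rfl
      exact not_isSquare_two_zmod hp8 (by simpa using hsq)
    obtain ⟨P, Q, hne, hPQ, hNP, hNQ⟩ :=
      exists_prime_mul_prime_of_isSquare hp4 hα hdeg hl hl2 hlp hsq
    rw [card_absNorm_eq_pow_of_split (prime_of_prime_absNorm (by rwa [hNP]))
      (prime_of_prime_absNorm (by rwa [hNQ])) hne hl hPQ hNP hNQ,
      (quadraticChar_one_iff_isSquare hl0).2 hsq]
    simp
  · rw [card_absNorm_eq_pow_of_inert (prime_span_of_not_isSquare hp8 hα hdeg hl hsq) hl rfl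
      (absNorm_span_natCast_of_finrank_eq_two hdeg l),
      quadraticChar_neg_one_iff_not_isSquare.2 hsq, Int.cast_neg, Int.cast_one,
      neg_one_geom_sum]
    simp only [Nat.even_add_one]
    split_ifs <;> simp

theorem idealCount_eq_zetaMul [Fact p.Prime] (hp8 : p % 8 = 5) (hα : α ^ 2 = p)
    (hdeg : Module.finrank ℚ K = 2) :
    idealCount K = DirichletCharacter.zetaMul (quadraticCharTo p ℂ) := by
  refine (ArithmeticFunction.IsMultiplicative.eq_iff_eq_on_prime_powers _
    (isMultiplicative_idealCount K) _ (DirichletCharacter.isMultiplicative_zetaMul _)).2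
    fun l k hl ↦ ?_
  rw [idealCount_prime_pow hp8 hα hdeg hl]
  refine Eq.symm ((ArithmeticFunction.coe_zeta_mul_apply).trans ?_)
  rw [Nat.sum_divisors_prime_pow hl]
  refine Finset.sum_congr rfl fun i _ ↦ ?_
  simp [toArithmeticFunction, hl.ne_zero]

open Filter Topology in
theorem tendsto_LSeries_quadraticCharTo [Fact p.Prime] (hp8 : p % 8 = 5) (hα : α ^ 2 = p)
    (hdeg : Module.finrank ℚ K = 2) :
    Tendsto (fun s : ℝ ↦ LSeries (fun n ↦ quadraticCharTo p ℂ n) s) (𝓝[>] 1)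
      (𝓝 (dedekindZeta_residue K : ℂ)) := by
  have hprod : ∀ s : ℝ, 1 < s →
      dedekindZeta K s = riemannZeta s * LSeries (fun n ↦ quadraticCharTo p ℂ n) s := by
    intro s hs
    have hs' : 1 < (s : ℂ).re := by simpa using hs
    have h1 : dedekindZeta K s = LSeries (idealCount K ·) s :=
      LSeries_congr (fun hn ↦ (idealCount_apply hn).symm) s
    rw [h1, idealCount_eq_zetaMul hp8 hα hdeg, DirichletCharacter.zetaMul,
      ArithmeticFunction.LSeries_mul', ← ArithmeticFunction.LSeries_zeta_eq_riemannZeta hs']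
    · congr 1
      exact LSeries_congr (fun hn ↦ by simp [toArithmeticFunction, hn]) s
    · exact ArithmeticFunction.LSeriesSummable_zeta_iff.2 hs'
    · refine LSeriesSummable_of_bounded_of_one_lt_re (m := 1) (fun n hn ↦ ?_) hs'
      simpa only [toArithmeticFunction, ArithmeticFunction.coe_mk, hn, ↓reduceIte]
        using DirichletCharacter.norm_le_one _ _
  have hzeta : Tendsto (fun s : ℝ ↦ ((s : ℂ) - 1) * riemannZeta s) (𝓝[>] 1) (𝓝 1) := by
    refine riemannZeta_residue_one.comp (tendsto_nhdsWithin_iff.2 ⟨?_, ?_⟩)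
    · exact (Complex.continuous_ofReal.tendsto' 1 1 (by simp)).mono_left nhdsWithin_le_nhds
    · filter_upwards [self_mem_nhdsWithin] with s hs
      simpa using (Set.mem_Ioi.1 hs).ne'
  have := (tendsto_sub_one_mul_dedekindZeta_nhdsGT K).div hzeta one_ne_zero
  rw [div_one] at this
  refine this.congr' ?_
  filter_upwards [self_mem_nhdsWithin] with s hs
  have hs1 : (s : ℂ) - 1 ≠ 0 := by
    rw [sub_ne_zero]
    simpa using (Set.mem_Ioi.1 hs).ne'
  have hz : riemannZeta s ≠ 0 := riemannZeta_ne_zero_of_one_lt_re (by simpa using hs)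
  rw [Pi.div_apply, hprod s hs]
  field_simp

end QuadraticIdealCount

section GaussPeriod

theorem gcd_div_orderOf_eq_div_orderOf_pow {G : Type*} [Monoid G] {x : G} {n k : ℕ} (hn : 0 < n)
    (hk : 0 < k) (hx : x ^ (n * k) = 1) :
    Nat.gcd (n * k / orderOf x) n = n / orderOf (x ^ k) := by
  have ho : 0 < orderOf x := orderOf_pos_iff.2
    (isOfFinOrder_iff_pow_eq_one.2 ⟨n * k, Nat.mul_pos hn hk, hx⟩)
  obtain ⟨c, hc⟩ := orderOf_dvd_of_pow_eq_one hx
  rw [hc, Nat.mul_div_cancel_left _ ho, orderOf_pow' x hk.ne']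
  obtain ⟨b, hb⟩ := Nat.gcd_dvd_left (orderOf x) k
  have hg : 0 < (orderOf x).gcd k := Nat.gcd_pos_of_pos_left _ ho
  have hdiv : orderOf x / (orderOf x).gcd k = b :=
    Nat.div_eq_of_eq_mul_right hg hb
  have hb0 : 0 < b := Nat.pos_of_ne_zero fun h ↦ by
    rw [h, mul_zero] at hb
    omega
  rw [hdiv]
  refine (Nat.div_eq_of_eq_mul_left hb0 ?_).symm
  refine Nat.eq_of_mul_eq_mul_left hg ?_
  calc (orderOf x).gcd k * n = (n * k).gcd (n * orderOf x) := by
        rw [Nat.gcd_mul_left, Nat.gcd_comm k, mul_comm]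
    _ = orderOf x * c.gcd n := by rw [hc, mul_comm n, Nat.gcd_mul_left]
    _ = (orderOf x).gcd k * (c.gcd n * b) := by
        conv_lhs => rw [hb]
        ring

theorem orderOf_neg_eq_of_pow_eq_neg_one {R : Type*} [CommRing R] {q : ℕ} [CharP R q]
    (hq : q.Prime) {x : R} (hx : x ^ (q + 1) = -1) : orderOf (-x) = orderOf x := by
  rcases hq.eq_two_or_odd' with rfl | hodd
  · rw [CharTwo.neg_eq]
  · have key {y : R} (hy : y ^ (q + 1) = -1) : orderOf (-y) ∣ orderOf y := by
      have : -y = y ^ (q + 2) := by rw [pow_succ, hy, neg_one_mul]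
      rw [this]
      exact orderOf_pow_dvd _
    refine Nat.dvd_antisymm (key hx) ?_
    have h := key (y := -x) (by rw [hodd.add_one.neg_pow, hx])
    rwa [neg_neg] at h

theorem neg_one_pow_of_odd_or_charTwo {R : Type*} [CommRing R] {q : ℕ} [CharP R q]
    (hq : q.Prime) : (-1 : R) ^ q = -1 := by
  rcases hq.eq_two_or_odd' with rfl | hodd
  · rw [CharTwo.neg_eq, one_pow]
  · exact hodd.neg_one_pow

theorem neg_one_pow_sum_pow {R : Type*} [CommRing R] {q : ℕ} [CharP R q]
    (hq : q.Prime) {t : ℕ} (ht : Odd t) : (-1 : R) ^ ∑ i ∈ Finset.range t, q ^ i = -1 := by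
  have hpow (i : ℕ) : (-1 : R) ^ q ^ i = -1 := by
    induction i with
    | zero => simp
    | succ i ih => rw [pow_succ, pow_mul, ih, neg_one_pow_of_odd_or_charTwo hq]
  rw [← Finset.prod_pow_eq_pow_sum]
  simp [hpow, ht.neg_one_pow]

theorem sum_range_pow_sq_mul (q m : ℕ) :
    (∑ j ∈ Finset.range m, q ^ (2 * j)) * (q + 1) = ∑ i ∈ Finset.range (2 * m), q ^ i := by
  induction m with
  | zero => simp
  | succ m ih =>
    rw [Finset.sum_range_succ, add_mul, ih, show 2 * (m + 1) = 2 * m + 1 + 1 by ring,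
      Finset.sum_range_succ, Finset.sum_range_succ]
    ring

variable {F : Type*} [Field F] {p q : ℕ} {ζ : F}

theorem pow_eq_pow_of_natCast_eq (hζ : ζ ^ p = 1) {a b : ℕ}
    (h : (a : ZMod p) = b) : ζ ^ a = ζ ^ b := by
  rw [pow_eq_pow_mod a hζ, pow_eq_pow_mod b hζ, (ZMod.natCast_eq_natCast_iff' a b p).1 h]

theorem sub_inv_pow_char_pow [hq : Fact q.Prime] [CharP F q] (n : ℕ) :
    (ζ - ζ⁻¹) ^ q ^ n = ζ ^ q ^ n - (ζ ^ q ^ n)⁻¹ := by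
  rw [sub_pow_char_pow, inv_pow]

theorem add_inv_pow_char_pow [hq : Fact q.Prime] [CharP F q] (n : ℕ) :
    (ζ + ζ⁻¹) ^ q ^ n = ζ ^ q ^ n + (ζ ^ q ^ n)⁻¹ := by
  rw [add_pow_char_pow, inv_pow]

/-- The norm of the Gauss period `ζ + ζ⁻¹` from `𝔽_{q^M}` to `𝔽_q` is `-1` when `q^M ≡ -1` and
`2` is an odd power of `q` modulo `p`. -/
theorem add_inv_pow_sum_pow_eq_neg_one [Fact q.Prime] [CharP F q] (hp2 : 2 < p)
    (hζ : IsPrimitiveRoot ζ p) {M t : ℕ} (hM : (q : ZMod p) ^ M = -1) (ht : Odd t)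
    (h2 : (q : ZMod p) ^ t = 2) :
    (ζ + ζ⁻¹) ^ ∑ i ∈ Finset.range M, q ^ i = -1 := by
  have hq : q.Prime := Fact.out
  have hζ0 : ζ ≠ 0 := hζ.ne_zero (by omega)
  have hγ : ζ - ζ⁻¹ ≠ 0 := by
    intro h
    have h1 : ζ ^ 2 = 1 := by
      rw [sub_eq_zero] at h
      rw [sq]
      nth_rewrite 1 [h]
      exact inv_mul_cancel₀ hζ0
    exact absurd (Nat.le_of_dvd two_pos (hζ.dvd_of_pow_eq_one 2 h1)) (by omega)
  have hα : (ζ - ζ⁻¹) * (ζ + ζ⁻¹) = (ζ - ζ⁻¹) * (ζ - ζ⁻¹) ^ (q ^ t - 1) := by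
    rw [mul_pow_sub_one (pow_ne_zero _ hq.ne_zero), sub_inv_pow_char_pow,
      pow_eq_pow_of_natCast_eq hζ.pow_eq_one (b := 2) (by push_cast; exact h2)]
    field_simp
    ring
  have hα' := mul_left_cancel₀ hγ hα
  have hN : (ζ - ζ⁻¹) ^ (q ^ M - 1) = -1 := by
    refine mul_left_cancel₀ hγ ?_
    have hinv : ζ ^ q ^ M = ζ⁻¹ := by
      refine eq_inv_of_mul_eq_one_left ?_
      rw [← pow_succ]
      refine (pow_eq_pow_of_natCast_eq hζ.pow_eq_one (b := 0) ?_).trans (pow_zero ζ)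
      push_cast; rw [hM]; ring
    rw [mul_pow_sub_one (pow_ne_zero _ hq.ne_zero), sub_inv_pow_char_pow, hinv, inv_inv]
    ring
  have hgeom (n : ℕ) : q ^ n - 1 = (∑ i ∈ Finset.range n, q ^ i) * (q - 1) := by
    have := Nat.geomSum_eq hq.two_le n
    rw [this, Nat.div_mul_cancel (by simpa using Nat.sub_dvd_pow_sub_pow q 1 n)]
  rw [hα', ← pow_mul, hgeom, mul_assoc, mul_comm (q - 1), ← hgeom, mul_comm, pow_mul, hN,
    neg_one_pow_sum_pow hq ht]

theorem pow_sq_sub_one_eq_one_of_pow_eq_neg_one [CharP F q] (hq : q.Prime) {x : F}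
    (hx : x ^ (q + 1) = -1) : x ^ (q ^ 2 - 1) = 1 := by
  have h : q ^ 2 - 1 = (q + 1) * (q - 1) := by simpa using Nat.sq_sub_sq q 1
  have h1 : (-1 : F) * (-1) ^ (q - 1) = -1 * 1 := by
    rw [mul_pow_sub_one hq.ne_zero, neg_one_pow_of_odd_or_charTwo hq, mul_one]
  rw [h, pow_mul, hx]
  exact mul_left_cancel₀ (neg_ne_zero.2 one_ne_zero) h1

end GaussPeriod

section SemiprimitiveRoot

variable {p q : ℕ} [Fact p.Prime]

theorem quadraticChar_eq_neg_one_of_closure_eq_top (hp4 : p % 4 = 1) (hqu : IsUnit (q : ZMod p))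
    (hgen : Subgroup.closure ({-1, hqu.unit} : Set (ZMod p)ˣ) = ⊤) :
    quadraticChar (ZMod p) q = -1 := by
  rcases quadraticChar_dichotomy hqu.ne_zero with h1 | h1
  · exfalso
    obtain ⟨a, ha⟩ := quadraticChar_exists_neg_one' (F := ZMod p) (ringChar_zmod_ne_two hp4)
    let f : (ZMod p)ˣ →* ℤ := (quadraticChar (ZMod p)).toMonoidHom.comp (Units.coeHom (ZMod p))
    have hf : f = 1 := by
      refine MonoidHom.eq_of_eqOn_dense hgen ?_
      rintro x (rfl | rfl)
      · exact quadraticChar_neg_one_eq_one hp4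
      · exact h1
    have h2 : f a = 1 := by rw [hf]; rfl
    have h3 : f a = -1 := ha
    omega
  · exact h1

theorem natCast_pow_half_eq_neg_one (hp4 : p % 4 = 1) (h : quadraticChar (ZMod p) q = -1) :
    (q : ZMod p) ^ ((p - 1) / 2) = -1 := by
  have h1 := quadraticChar_eq_pow_of_char_ne_two' (F := ZMod p) (ringChar_zmod_ne_two hp4) q
  rw [h, ZMod.card, show p / 2 = (p - 1) / 2 by omega] at h1
  rw [← h1]
  simp

theorem zpowers_eq_top_of_closure_eq_top (hqu : IsUnit (q : ZMod p))
    (hgen : Subgroup.closure ({-1, hqu.unit} : Set (ZMod p)ˣ) = ⊤) {M : ℕ}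
    (hM : (q : ZMod p) ^ M = -1) : Subgroup.zpowers hqu.unit = ⊤ := by
  rw [eq_top_iff, ← hgen, Subgroup.closure_le]
  rintro x (rfl | rfl)
  · exact Subgroup.mem_zpowers_iff.2 ⟨M, by
      ext
      simpa using hM⟩
  · exact Subgroup.mem_zpowers _

theorem exists_natCast_pow_eq (hqu : IsUnit (q : ZMod p))
    (hz : Subgroup.zpowers hqu.unit = ⊤) {a : ZMod p} (ha : a ≠ 0) :
    ∃ t : ℕ, (q : ZMod p) ^ t = a := by
  have h : (Units.mk0 a ha) ∈ Subgroup.zpowers hqu.unit := hz ▸ Subgroup.mem_top _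
  obtain ⟨t, ht⟩ := (isOfFinOrder_of_finite _).mem_zpowers_iff_mem_range_orderOf.1 h |>
    Finset.mem_image.1
  exact ⟨t, by simpa using congrArg Units.val ht.2⟩

theorem quadraticChar_natCast_pow (h : quadraticChar (ZMod p) q = -1) (n : ℕ) :
    quadraticChar (ZMod p) ((q : ZMod p) ^ n) = (-1) ^ n := by
  rw [map_pow, h]

theorem exists_odd_natCast_pow_eq (hqu : IsUnit (q : ZMod p))
    (hz : Subgroup.zpowers hqu.unit = ⊤) {a : ZMod p} (ha : ¬ IsSquare a) :
    ∃ t : ℕ, Odd t ∧ (q : ZMod p) ^ t = a := by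
  have ha0 : a ≠ 0 := by
    rintro rfl
    exact ha (IsSquare.zero)
  obtain ⟨t, rfl⟩ := exists_natCast_pow_eq hqu hz ha0
  refine ⟨t, ?_, rfl⟩
  by_contra ht
  exact ha ((Nat.not_odd_iff_even.1 ht).isSquare_pow _)

/-- Reindexing of a sum over the nonzero residues modulo `p` by the powers of a generator. -/
theorem sum_zmod_eq_sum_range_natCast_pow {A : Type*} [AddCommMonoid A] (hqu : IsUnit (q : ZMod p))
    (hz : Subgroup.zpowers hqu.unit = ⊤) (f : ZMod p → A) (hf : f 0 = 0) :
    ∑ a : ZMod p, f a = ∑ n ∈ Finset.range (p - 1), f ((q : ZMod p) ^ n) := by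
  classical
  have ho : orderOf hqu.unit = p - 1 := by
    rw [orderOf_eq_card_of_zpowers_eq_top hz, Nat.card_eq_fintype_card, ZMod.card_units]
  have hgen : ∀ x, x ∈ Subgroup.zpowers hqu.unit := fun x ↦ hz ▸ Subgroup.mem_top x
  have h1 : ∑ u : (ZMod p)ˣ, f u = ∑ n ∈ Finset.range (p - 1), f ((q : ZMod p) ^ n) := by
    rw [← IsCyclic.image_range_orderOf hgen, ho, Finset.sum_image]
    · simp
    · intro a ha b hb hab
      rw [Finset.coe_range, ← ho] at ha hb
      exact pow_injOn_Iio_orderOf ha hb hab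
  rw [← h1]
  symm
  refine Finset.sum_of_injOn (fun u : (ZMod p)ˣ ↦ (u : ZMod p)) (fun a _ b _ h ↦ Units.ext h)
    (fun a _ ↦ by simp) (fun a _ ha ↦ ?_) (fun a _ ↦ rfl)
  have : a = 0 := by
    by_contra h
    exact ha ⟨Units.mk0 a h, by simp, rfl⟩
  rw [this, hf]

end SemiprimitiveRoot

theorem sum_range_two_mul_one_add_neg_one_pow {R : Type*} [Ring R] (f : ℕ → R) (m : ℕ) :
    ∑ n ∈ Finset.range (2 * m), (1 + (-1) ^ n) * f n = 2 * ∑ j ∈ Finset.range m, f (2 * j) := by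
  induction m with
  | zero => simp
  | succ m ih =>
    rw [show 2 * (m + 1) = 2 * m + 1 + 1 by ring, Finset.sum_range_succ, Finset.sum_range_succ, ih,
      Finset.sum_range_succ, (even_two_mul m).neg_one_pow, (even_two_mul m).add_one.neg_one_pow,
      mul_add, one_add_one_eq_two, add_neg_cancel, zero_mul, add_zero]

theorem quadraticChar_mul_sum_quadraticChar_mul {p : ℕ} [Fact p.Prime] (L : ZMod p → ℝ)
    {c : ZMod p} (hc : c ≠ 0) :
    (quadraticChar (ZMod p) c : ℝ) * ∑ a : ZMod p, (quadraticChar (ZMod p) a : ℝ) * L (c * a) =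
      ∑ a : ZMod p, (quadraticChar (ZMod p) a : ℝ) * L a := by
  rw [Finset.mul_sum,
    ← Equiv.sum_comp (Equiv.mulLeft₀ c hc) fun a ↦ (quadraticChar (ZMod p) a : ℝ) * L a]
  refine Finset.sum_congr rfl fun a _ ↦ ?_
  rw [Equiv.mulLeft₀_apply, map_mul]
  push_cast
  ring

/-- Half of the logarithmic sum in the class number formula is the logarithm of a product of
Gauss periods. -/
theorem two_mul_log_norm_prod_add_inv {p q : ℕ} [Fact p.Prime] (hp8 : p % 8 = 5)
    (hqu : IsUnit (q : ZMod p)) (hz : Subgroup.zpowers hqu.unit = ⊤)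
    (hχ : quadraticChar (ZMod p) q = -1) {m : ℕ} (hm : p - 1 = 2 * (2 * m))
    (hM : (q : ZMod p) ^ (2 * m) = -1) {ζ : ℂ} (hζ : IsPrimitiveRoot ζ p) :
    2 * Real.log ‖∏ j ∈ Finset.range m, (ζ ^ q ^ (2 * j) + (ζ ^ q ^ (2 * j))⁻¹)‖ =
      ∑ a : ZMod p, (quadraticChar (ZMod p) a : ℝ) * Real.log ‖1 - ζ ^ a.val‖ := by
  have hp : p.Prime := Fact.out
  have hζ0 : ζ ≠ 0 := hζ.ne_zero hp.ne_zero
  have hnorm : ‖ζ‖ = 1 := hζ.norm'_eq_one hp.ne_zero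
  have h2 : (2 : ZMod p) ≠ 0 := by
    intro h
    exact not_isSquare_two_zmod hp8 (h ▸ IsSquare.zero)
  have h4 : (4 : ZMod p) ≠ 0 := by
    rw [show (4 : ZMod p) = 2 * 2 by norm_num]
    exact mul_ne_zero h2 h2
  set L : ZMod p → ℝ := fun a ↦ Real.log ‖1 - ζ ^ a.val‖ with hL
  set g : ZMod p → ℝ := fun a ↦ L (4 * a) - L (2 * a) with hg
  set G : ℕ → ℝ := fun n ↦ Real.log ‖ζ ^ q ^ n + (ζ ^ q ^ n)⁻¹‖ with hG
  have hLn (n : ℕ) : L n = Real.log ‖1 - ζ ^ n‖ := by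
    simp only [hL]
    rw [pow_eq_pow_of_natCast_eq hζ.pow_eq_one (b := n) (by simp)]
  have hne {n : ℕ} (hn : (n : ZMod p) ≠ 0) : 1 - ζ ^ n ≠ 0 := by
    rw [sub_ne_zero]
    intro h
    exact hn ((ZMod.natCast_eq_zero_iff n p).2 (hζ.dvd_of_pow_eq_one n h.symm))
  have hmul (c n : ℕ) (hc : (c : ZMod p) ≠ 0) : 1 - ζ ^ (c * q ^ n) ≠ 0 := by
    refine hne ?_
    push_cast
    exact mul_ne_zero hc (pow_ne_zero _ hqu.ne_zero)
  have h2' (n : ℕ) : 1 - ζ ^ (2 * q ^ n) ≠ 0 := hmul 2 n (by exact_mod_cast h2)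
  have h4' (n : ℕ) : 1 - ζ ^ (4 * q ^ n) ≠ 0 := hmul 4 n (by exact_mod_cast h4)
  have hfac (n : ℕ) : (1 - ζ ^ (4 * q ^ n)) / (1 - ζ ^ (2 * q ^ n)) =
      ζ ^ q ^ n * (ζ ^ q ^ n + (ζ ^ q ^ n)⁻¹) := by
    rw [div_eq_iff (h2' n), mul_add, mul_inv_cancel₀ (pow_ne_zero _ hζ0), mul_comm 4,
      mul_comm 2, pow_mul, pow_mul]
    ring
  have hgG (n : ℕ) : g ((q : ZMod p) ^ n) = G n := by
    have e4 : (4 : ZMod p) * (q : ZMod p) ^ n = (4 * q ^ n : ℕ) := by push_cast; rfl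
    have e2 : (2 : ZMod p) * (q : ZMod p) ^ n = (2 * q ^ n : ℕ) := by push_cast; rfl
    simp only [hg, hG]
    rw [e4, e2, hLn, hLn, ← Real.log_div (norm_ne_zero_iff.2 (h4' n))
      (norm_ne_zero_iff.2 (h2' n)), ← norm_div, hfac, norm_mul, norm_pow, hnorm, one_pow, one_mul]
  have hGper (n : ℕ) : G (2 * m + n) = G n := by
    simp only [hG]
    have : ζ ^ q ^ (2 * m + n) = (ζ ^ q ^ n)⁻¹ := by
      refine eq_inv_of_mul_eq_one_left ?_
      rw [← pow_add]
      refine (pow_eq_pow_of_natCast_eq hζ.pow_eq_one (b := 0) ?_).trans (pow_zero ζ)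
      push_cast
      rw [pow_add, hM]
      ring
    rw [this, inv_inv, add_comm]
  set S := ∑ a : ZMod p, (quadraticChar (ZMod p) a : ℝ) * L a with hS
  have hχ2 : quadraticChar (ZMod p) 2 = -1 :=
    quadraticChar_neg_one_iff_not_isSquare.2 (not_isSquare_two_zmod hp8)
  have hχ4 : quadraticChar (ZMod p) 4 = 1 := by
    rw [show (4 : ZMod p) = 2 * 2 by norm_num, map_mul, hχ2]
    norm_num
  have hS2 := quadraticChar_mul_sum_quadraticChar_mul L h2
  have hS4 := quadraticChar_mul_sum_quadraticChar_mul L h4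
  rw [hχ2] at hS2
  rw [hχ4] at hS4
  push_cast at hS2 hS4
  have hsumg : ∑ a : ZMod p, g a = 0 := by
    simp only [hg, Finset.sum_sub_distrib]
    exact sub_eq_zero.2 ((Equiv.sum_comp (Equiv.mulLeft₀ 4 h4) L).trans
      (Equiv.sum_comp (Equiv.mulLeft₀ 2 h2) L).symm)
  have hsumχg : ∑ a : ZMod p, (quadraticChar (ZMod p) a : ℝ) * g a = 2 * S := by
    simp only [hg, mul_sub, Finset.sum_sub_distrib]
    linarith
  have hg0 : g 0 = 0 := by simp [hg]
  have htotal : ∑ a : ZMod p, (1 + (quadraticChar (ZMod p) a : ℝ)) * g a =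
      4 * ∑ j ∈ Finset.range m, G (2 * j) := by
    rw [sum_zmod_eq_sum_range_natCast_pow hqu hz _ (by rw [hg0, mul_zero]), hm]
    have : ∀ n, (1 + (quadraticChar (ZMod p) ((q : ZMod p) ^ n) : ℝ)) * g ((q : ZMod p) ^ n) =
        (1 + (-1) ^ n) * G n := by
      intro n
      rw [hgG, quadraticChar_natCast_pow hχ]
      push_cast
      rfl
    rw [Finset.sum_congr rfl fun n _ ↦ this n, sum_range_two_mul_one_add_neg_one_pow, two_mul m,
      Finset.sum_range_add]
    have : ∀ j, G (2 * (m + j)) = G (2 * j) := fun j ↦ by rw [mul_add, hGper]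
    simp only [this]
    ring
  have hlog : Real.log ‖∏ j ∈ Finset.range m, (ζ ^ q ^ (2 * j) + (ζ ^ q ^ (2 * j))⁻¹)‖ =
      ∑ j ∈ Finset.range m, G (2 * j) := by
    rw [norm_prod, Real.log_prod]
    intro j _
    refine norm_ne_zero_iff.2 (right_ne_zero_of_mul (a := ζ ^ q ^ (2 * j)) ?_)
    rw [← hfac]
    exact div_ne_zero (h4' _) (h2' _)
  simp only [add_mul, one_mul, Finset.sum_add_distrib, hsumg, hsumχg] at htotal
  rw [hlog]
  linarith
/-- The class number formula, expressed by a product of Gauss periods. -/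
theorem abs_log_norm_prod_add_inv {p q : ℕ} [Fact p.Prime] (hp8 : p % 8 = 5)
    (hqu : IsUnit (q : ZMod p)) (hz : Subgroup.zpowers hqu.unit = ⊤)
    (hχ : quadraticChar (ZMod p) q = -1) {m : ℕ} (hm : p - 1 = 2 * (2 * m))
    (hM : (q : ZMod p) ^ (2 * m) = -1) {ζ : ℂ} (hζ : IsPrimitiveRoot ζ p)
    {K : Type*} [Field K] [NumberField K] {α : K} (hα : α ^ 2 = p)
    (hdeg : Module.finrank ℚ K = 2) (ε : (𝓞 K)ˣ)
    (hfund : ∀ u : (𝓞 K)ˣ, ∃ n : ℤ, u = ε ^ n ∨ u = -ε ^ n) (w : InfinitePlace K) :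
    |Real.log ‖∏ j ∈ Finset.range m, (ζ ^ q ^ (2 * j) + (ζ ^ q ^ (2 * j))⁻¹)‖| =
      |Real.log (w ((ε : 𝓞 K) ^ classNumber K : 𝓞 K))| := by
  have hp : p.Prime := Fact.out
  have hp4 : p % 4 = 1 := by omega
  have := isTotallyReal_of_sq_eq_prime hp hα hdeg
  have h1 := abs_mul_sqrt_eq_of_tendsto_LSeries hp4 hζ (tendsto_LSeries_quadraticCharTo hp8 hα hdeg)
  have h2 := dedekindZeta_residue_mul_sqrt hp hp4 hα hdeg
  have h3 := two_mul_log_norm_prod_add_inv hp8 hqu hz hχ hm hM hζ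
  rw [regulator_eq_abs_log_of_finrank_eq_two hdeg ε hfund w] at h2
  have h4 : |dedekindZeta_residue K * √p| = |dedekindZeta_residue K| * √p := by
    rw [abs_mul, abs_of_nonneg (Real.sqrt_nonneg _)]
  rw [← h3, ← h4, h2, abs_mul, abs_mul, abs_mul, abs_abs, Nat.abs_cast] at h1
  push_cast
  rw [map_pow, Real.log_pow, abs_mul, Nat.abs_cast]
  norm_num at h1 ⊢
  linarith

theorem aeval_eq_zero_of_isPrimitiveRoot {R S : Type*} [CommRing R] [IsDomain R] [Field S]
    [CharZero S] {n : ℕ} (hn : 0 < n) {ζ : S} (hζ : IsPrimitiveRoot ζ n) {ξ : R}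
    (hξ : IsPrimitiveRoot ξ n) {P : Polynomial ℤ} (h : Polynomial.aeval ζ P = 0) :
    Polynomial.aeval ξ P = 0 := by
  have hdvd : Polynomial.cyclotomic n ℤ ∣ P := by
    rw [Polynomial.cyclotomic_eq_minpoly hζ hn]
    exact minpoly.isIntegrallyClosed_dvd (hζ.isIntegral hn) h
  obtain ⟨Q, rfl⟩ := hdvd
  have h0 : Polynomial.aeval ξ (Polynomial.cyclotomic n ℤ) = 0 := by
    rw [Polynomial.aeval_def, ← Polynomial.eval_map, Polynomial.map_cyclotomic]
    exact hξ.isRoot_cyclotomic hn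
  rw [map_mul, h0, zero_mul]

/-- A polynomial whose value at a primitive `p`-th root of unity `ζ` is `(1 + τ) / 2`, where `τ` is
the quadratic Gauss sum attached to `ζ`. -/
noncomputable def halfGaussPoly (p : ℕ) [Fact p.Prime] : Polynomial ℤ :=
  1 + ∑ a : ZMod p with quadraticChar (ZMod p) a = 1, Polynomial.X ^ a.val

theorem two_mul_aeval_halfGaussPoly {p : ℕ} [Fact p.Prime] {R : Type*} [CommRing R] [IsDomain R]
    {ζ : R} (hζ : IsPrimitiveRoot ζ p) :
    2 * Polynomial.aeval ζ (halfGaussPoly p) =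
      1 + gaussSum (quadraticCharTo p R) (AddChar.zmodChar p hζ.pow_eq_one) := by
  have hp : p.Prime := Fact.out
  have hsum : ∑ a : ZMod p, ζ ^ a.val = 0 := by
    have hprim := AddChar.zmodChar_primitive_of_primitive_root p hζ one_ne_zero
    rw [AddChar.mulShift_one] at hprim
    have := AddChar.sum_eq_zero_of_ne_one hprim
    simpa only [AddChar.zmodChar_apply] using this
  have h1 : ∑ a : ZMod p, (1 + quadraticCharTo p R a) * ζ ^ a.val =
      1 + 2 * ∑ a : ZMod p with quadraticChar (ZMod p) a = 1, ζ ^ a.val := by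
    have hs (a : ZMod p) : (1 + quadraticCharTo p R a) * ζ ^ a.val =
        (if a = 0 then 1 else 0) + 2 * if quadraticChar (ZMod p) a = 1 then ζ ^ a.val else 0 := by
      rw [quadraticCharTo_apply]
      rcases eq_or_ne a 0 with rfl | ha
      · simp
      · rcases quadraticChar_dichotomy ha with h | h
        · rw [h, if_neg ha, if_pos rfl]
          push_cast
          ring
        · rw [h, if_neg ha, if_neg (by decide)]
          push_cast
          ring
    simp only [hs, Finset.sum_add_distrib, ← Finset.mul_sum, Finset.sum_filter]
    simp
  have h2 : ∑ a : ZMod p, (1 + quadraticCharTo p R a) * ζ ^ a.val =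
      gaussSum (quadraticCharTo p R) (AddChar.zmodChar p hζ.pow_eq_one) := by
    simp only [add_mul, one_mul, Finset.sum_add_distrib, hsum, zero_add, gaussSum,
      AddChar.zmodChar_apply]
  rw [← h2, h1, halfGaussPoly]
  simp only [map_add, map_one, map_sum, map_pow, Polynomial.aeval_X]
  ring

theorem aeval_halfGaussPoly_sq {p : ℕ} [Fact p.Prime] (hp4 : p % 4 = 1) {R : Type*} [CommRing R]
    [IsDomain R] {ξ : R} (hξ : IsPrimitiveRoot ξ p) :
    Polynomial.aeval ξ (halfGaussPoly p) ^ 2 =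
      Polynomial.aeval ξ (halfGaussPoly p) + (p / 4 : ℕ) := by
  have hp : p.Prime := Fact.out
  have hζ := Complex.isPrimitiveRoot_exp p hp.ne_zero
  have h1 := two_mul_aeval_halfGaussPoly hζ
  have h2 := gaussSum_quadraticCharTo_sq hp4 hζ
  have h3 : (p : ℂ) = 4 * (p / 4 : ℕ) + 1 := by
    have : p = 4 * (p / 4) + 1 := by omega
    exact_mod_cast this
  have h0 : Polynomial.aeval (Complex.exp (2 * Real.pi * Complex.I / p))
      (halfGaussPoly p ^ 2 - halfGaussPoly p - ((p / 4 : ℕ) : Polynomial ℤ)) = 0 := by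
    simp only [map_sub, map_pow, map_natCast]
    rw [← sub_eq_iff_eq_add'.2 h1] at h2
    linear_combination (h2 + h3) / 4
  have h := aeval_eq_zero_of_isPrimitiveRoot hp.pos hζ hξ h0
  simp only [map_sub, map_pow, map_natCast] at h
  linear_combination h

theorem exists_ringHom_halfOneAddSqrt_eq {p : ℕ} {K : Type*} [Field K] [NumberField K] {α : K}
    (hp : p.Prime) (hp4 : p % 4 = 1) (hα : α ^ 2 = p) (hdeg : Module.finrank ℚ K = 2)
    {R : Type*} [CommRing R] {t : R} (ht : t ^ 2 = t + (p / 4 : ℕ)) :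
    ∃ φ : 𝓞 K →+* R, φ (halfOneAddSqrt hp4 hα) = t := by
  set b := intBasisOneHalf hp hp4 hα hdeg with hb
  set θ := halfOneAddSqrt hp4 hα
  let f : 𝓞 K →ₗ[ℤ] R := b.constr ℤ ![1, t]
  have hcoe : ⇑b = ![1, θ] := coe_intBasisOneHalf hp hp4 hα hdeg
  have f1 : f 1 = 1 := by
    have := b.constr_basis ℤ ![1, t] 0
    rwa [hcoe] at this
  have fθ : f θ = t := by
    have := b.constr_basis ℤ ![1, t] 1
    rwa [hcoe] at this
  have hf (u v : ℤ) : f (u + v * θ) = u + v * t := by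
    rw [map_add, ← mul_one (u : 𝓞 K), ← zsmul_eq_mul, ← zsmul_eq_mul, map_zsmul, map_zsmul, f1, fθ,
      zsmul_eq_mul, zsmul_eq_mul, mul_one]
  have hθ : θ ^ 2 = θ + (p / 4 : ℕ) := halfOneAddSqrt_sq hp4 hα
  refine ⟨RingHom.mk' ⟨⟨f, f1⟩, fun x y ↦ ?_⟩ fun x y ↦ map_add f x y, fθ⟩
  generalize p / 4 = N at hθ ht
  obtain ⟨u, v, rfl⟩ := exists_int_add_mul_halfOneAddSqrt hp hp4 hα hdeg x
  obtain ⟨u', v', rfl⟩ := exists_int_add_mul_halfOneAddSqrt hp hp4 hα hdeg y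
  have hprod : ((u : 𝓞 K) + v * θ) * (u' + v' * θ) =
      ((u * u' + v * v' * N : ℤ) : 𝓞 K) + ((u * v' + v * u' + v * v' : ℤ) : 𝓞 K) * θ := by
    push_cast
    linear_combination (v * v' : 𝓞 K) * hθ
  change f _ = f _ * f _
  rw [hprod, hf, hf, hf]
  push_cast
  linear_combination -(v * v' : R) * ht

theorem eq_or_neg_or_mul_eq_of_abs_log_norm_eq {a b : ℂ} (ha : a ≠ 0) (hb : b ≠ 0)
    (har : starRingEnd ℂ a = a) (hbr : starRingEnd ℂ b = b)
    (h : |Real.log ‖a‖| = |Real.log ‖b‖|) :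
    a = b ∨ a = -b ∨ a * b = 1 ∨ a * b = -1 := by
  obtain ⟨r, rfl⟩ := Complex.conj_eq_iff_real.1 har
  obtain ⟨s, rfl⟩ := Complex.conj_eq_iff_real.1 hbr
  have hr : r ≠ 0 := by exact_mod_cast ha
  have hs : s ≠ 0 := by exact_mod_cast hb
  rw [Complex.norm_real, Complex.norm_real, Real.norm_eq_abs, Real.norm_eq_abs] at h
  suffices hrs : r = s ∨ r = -s ∨ r * s = 1 ∨ r * s = -1 by
    refine hrs.imp ?_ (Or.imp ?_ (Or.imp ?_ ?_)) <;> intro h <;> exact_mod_cast h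
  rw [← or_assoc, ← abs_eq_abs, ← abs_eq zero_le_one]
  rcases abs_eq_abs.1 h with h | h
  · exact Or.inl (Real.log_injOn_pos (abs_pos.2 hr) (abs_pos.2 hs) h)
  · right
    rw [← Real.log_inv] at h
    have := Real.log_injOn_pos (abs_pos.2 hr) (inv_pos.2 (abs_pos.2 hs)) h
    rw [abs_mul, this, inv_mul_cancel₀ (abs_ne_zero.2 hs)]

/-- An identity up to sign and inversion between a real cyclotomic number and a unit of the
quadratic subfield of conductor `p` persists in every domain with a primitive `p`-th root of
unity. -/
theorem exists_ringHom_eq_or_mul_eq {p : ℕ} [Fact p.Prime] {K : Type*} [Field K] [NumberField K]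
    {α : K} (hp4 : p % 4 = 1) (hα : α ^ 2 = p) (hdeg : Module.finrank ℚ K = 2)
    {R : Type*} [CommRing R] [IsDomain R] {ξ : R} (hξ : IsPrimitiveRoot ξ p)
    {ζ : ℂ} (hζ : IsPrimitiveRoot ζ p) {P : Polynomial ℤ} (hP0 : Polynomial.aeval ζ P ≠ 0)
    (hPr : starRingEnd ℂ (Polynomial.aeval ζ P) = Polynomial.aeval ζ P) {x : 𝓞 K} (hx : x ≠ 0)
    (hlog : ∀ w : InfinitePlace K, |Real.log ‖Polynomial.aeval ζ P‖| = |Real.log (w x)|) :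
    ∃ φ : 𝓞 K →+* R, Polynomial.aeval ξ P = φ x ∨ Polynomial.aeval ξ P = -φ x ∨
      Polynomial.aeval ξ P * φ x = 1 ∨ Polynomial.aeval ξ P * φ x = -1 := by
  have hp : p.Prime := Fact.out
  obtain ⟨u, v, rfl⟩ := exists_int_add_mul_halfOneAddSqrt hp hp4 hα hdeg x
  obtain ⟨φ, hφ⟩ := exists_ringHom_halfOneAddSqrt_eq hp hp4 hα hdeg (aeval_halfGaussPoly_sq hp4 hξ)
  obtain ⟨ψ, hψ⟩ := exists_ringHom_halfOneAddSqrt_eq hp hp4 hα hdeg (aeval_halfGaussPoly_sq hp4 hζ)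
  set θ := halfOneAddSqrt hp4 hα
  have hψinj : Function.Injective ψ := by
    rw [RingHom.injective_iff_ker_eq_bot]
    refine Ideal.eq_bot_of_comap_eq_bot (R := ℤ) ?_
    rw [RingHom.comap_ker, ← RingHom.injective_iff_ker_eq_bot]
    exact RingHom.injective_int _
  have := isTotallyReal_of_sq_eq_prime hp hα hdeg
  let σ : K →+* ℂ := IsFractionRing.lift hψinj
  have hσ (y : 𝓞 K) : σ y = ψ y := IsFractionRing.lift_algebraMap hψinj y
  have hσreal (y : K) : starRingEnd ℂ (σ y) = σ y :=
    RingHom.congr_fun (IsTotallyReal.complexEmbedding_isReal σ) y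
  set Q : Polynomial ℤ := (u : Polynomial ℤ) + (v : Polynomial ℤ) * halfGaussPoly p with hQ
  have hQψ : ψ (u + v * θ) = Polynomial.aeval ζ Q := by simp [hQ, hψ]
  have hQφ : φ (u + v * θ) = Polynomial.aeval ξ Q := by simp [hQ, hφ]
  refine ⟨φ, ?_⟩
  have key := eq_or_neg_or_mul_eq_of_abs_log_norm_eq hP0 (b := ψ (u + v * θ))
    ((map_ne_zero_iff _ hψinj).2 hx) hPr (by rw [← hσ]; exact hσreal _)
    (by rw [hlog (InfinitePlace.mk σ), InfinitePlace.apply, hσ])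
  have htr {A B : Polynomial ℤ} (h : Polynomial.aeval ζ A = Polynomial.aeval ζ B) :
      Polynomial.aeval ξ A = Polynomial.aeval ξ B := by
    rw [← sub_eq_zero, ← map_sub] at h ⊢
    exact aeval_eq_zero_of_isPrimitiveRoot hp.pos hζ hξ h
  rw [hQψ] at key
  rw [hQφ]
  simp only [← map_mul, ← map_neg] at key ⊢
  refine key.imp htr (Or.imp htr (Or.imp (fun h ↦ ?_) fun h ↦ ?_))
  · simpa using htr (A := P * Q) (B := 1) (by simpa using h)
  · simpa using htr (A := P * Q) (B := -1) (by simpa using h)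

theorem orderOf_eq_of_mul_eq_one {G : Type*} [CommMonoid G] {x y : G} (h : x * y = 1) :
    orderOf x = orderOf y := by
  refine orderOf_eq_orderOf_iff.2 fun n ↦ ?_
  have hn : x ^ n * y ^ n = 1 := by rw [← mul_pow, h, one_pow]
  exact ⟨fun h1 ↦ by rwa [h1, one_mul] at hn, fun h1 ↦ by rwa [h1, mul_one] at hn⟩

theorem IsPrimitiveRoot.add_inv_ne_zero_of_odd {F : Type*} [Field F] {p : ℕ} (hp2 : 2 < p)
    (hodd : Odd p) {ζ : F} (hζ : IsPrimitiveRoot ζ p) : ζ + ζ⁻¹ ≠ 0 := by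
  intro h
  have hζ0 : ζ ≠ 0 := hζ.ne_zero (by omega)
  have h2 : ζ ^ 2 = -1 := by
    linear_combination ζ * h - mul_inv_cancel₀ hζ0
  have h4 : p ∣ 2 * 2 := hζ.dvd_of_pow_eq_one _ (by rw [pow_mul, h2]; norm_num)
  have hc : p.Coprime 2 := hodd.coprime_two_right
  have := Nat.le_of_dvd two_pos (hc.dvd_of_dvd_mul_left h4)
  omega

/-- The integral polynomial whose value at `ζ` is the product of the `ζ ^ n + ζ ^ (-n)` with
`n = q ^ (2 * j)`, `j < m`, for every `p`-th root of unity `ζ`. -/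
noncomputable def gaussPeriodProdPoly (p q m : ℕ) : Polynomial ℤ :=
  ∏ j ∈ Finset.range m,
    (Polynomial.X ^ q ^ (2 * j) + Polynomial.X ^ (q ^ (2 * j) * (p - 1)))

theorem aeval_gaussPeriodProdPoly {F : Type*} [Field F] {p : ℕ} (hp : 0 < p) {ζ : F}
    (hζ : ζ ^ p = 1) (q m : ℕ) :
    Polynomial.aeval ζ (gaussPeriodProdPoly p q m) =
      ∏ j ∈ Finset.range m, (ζ ^ q ^ (2 * j) + (ζ ^ q ^ (2 * j))⁻¹) := by
  rw [gaussPeriodProdPoly, map_prod]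
  refine Finset.prod_congr rfl fun j _ ↦ ?_
  simp only [map_add, map_pow, Polynomial.aeval_X]
  congr 1
  refine eq_inv_of_mul_eq_one_left ?_
  rw [← pow_add, ← Nat.mul_add_one, Nat.sub_add_cancel hp, mul_comm, pow_mul, hζ, one_pow]

theorem orderOf_mk_eq_orderOf_map {A F : Type*} [CommRing A] [Ring F] [Nontrivial F] {I : Ideal A}
    (hI : I.IsMaximal) (φ : A →+* F) (h : I ≤ RingHom.ker φ) (x : A) :
    orderOf (Ideal.Quotient.mk I x) = orderOf (φ x) := by
  have hker : RingHom.ker φ ≤ I := (hI.eq_of_le (RingHom.ker_ne_top φ) h).ge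
  have := RingHom.lift_injective_of_ker_le_ideal I (fun a ha ↦ h ha) hker
  rw [← orderOf_injective (Ideal.Quotient.lift I φ fun a ha ↦ h ha : A ⧸ I →* F) this]
  rfl

/-- Main theorem: for a prime `p ≡ 5 (mod 8)` with `(ℤ/pℤ)* = ⟨-1, q⟩` and a primitive
`p`-th root of unity `ζ ∈ F_{q^{p-1}}`, the Gauss period `α = ζ + ζ⁻¹` satisfies
`gcd(ind(α), q² - 1) = ind(ε_p^{h_p} mod qO_K)`. -/
theorem stmt_16 (p q : ℕ) (hp : p.Prime) (hp8 : p % 8 = 5) (hq : q.Prime)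
    (hqu : IsUnit (q : ZMod p))
    (hgen : Subgroup.closure ({-1, hqu.unit} : Set (ZMod p)ˣ) = ⊤)
    (F : Type) [Field F] [Fintype F] (hF : Fintype.card F = q ^ (p - 1))
    (ζ : F) (hζ : IsPrimitiveRoot ζ p)
    (K : Type) [Field K] [NumberField K] (α : K) (hα : α ^ 2 = (p : K))
    (hdeg : Module.finrank ℚ K = 2)
    (ε : (𝓞 K)ˣ)
    (hfund : ∀ u : (𝓞 K)ˣ, ∃ n : ℤ, u = ε ^ n ∨ u = -ε ^ n)
    (hinert : Prime (q : 𝓞 K)) :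
    Nat.gcd ((q ^ ((p - 1) / 2) - 1) / orderOf (ζ + ζ⁻¹)) (q ^ 2 - 1) =
      (q ^ 2 - 1) /
        orderOf (Ideal.Quotient.mk (Ideal.span {(q : 𝓞 K)})
          ((ε : 𝓞 K) ^ classNumber K)) := by
  have : Fact p.Prime := ⟨hp⟩
  have : Fact q.Prime := ⟨hq⟩
  have : CharP F q := charP_of_card_eq_prime_pow hF
  have hp4 : p % 4 = 1 := by omega
  have hp2 : 2 < p := by omega
  obtain ⟨m, hm0, hm⟩ : ∃ m, 0 < m ∧ p - 1 = 2 * (2 * m) := ⟨(p - 1) / 4, by omega, by omega⟩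
  have hhalf : (p - 1) / 2 = 2 * m := by omega
  have hχ := quadraticChar_eq_neg_one_of_closure_eq_top hp4 hqu hgen
  have hM : (q : ZMod p) ^ (2 * m) = -1 := hhalf ▸ natCast_pow_half_eq_neg_one hp4 hχ
  have hz := zpowers_eq_top_of_closure_eq_top hqu hgen hM
  obtain ⟨t, ht, h2⟩ := exists_odd_natCast_pow_eq hqu hz (not_isSquare_two_zmod hp8)
  set k := ∑ j ∈ Finset.range m, q ^ (2 * j) with hk
  have hk0 : 0 < k := Finset.sum_pos (fun j _ ↦ pow_pos hq.pos _) ⟨0, by simpa using hm0⟩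
  have hβ : ((ζ + ζ⁻¹) ^ k) ^ (q + 1) = -1 := by
    rw [← pow_mul, sum_range_pow_sq_mul]
    exact add_inv_pow_sum_pow_eq_neg_one hp2 hζ hM ht h2
  have hβprod : Polynomial.aeval ζ (gaussPeriodProdPoly p q m) = (ζ + ζ⁻¹) ^ k := by
    rw [aeval_gaussPeriodProdPoly hp.pos hζ.pow_eq_one, hk, ← Finset.prod_pow_eq_pow_sum]
    exact Finset.prod_congr rfl fun j _ ↦ (add_inv_pow_char_pow _).symm
  have hn : q ^ ((p - 1) / 2) - 1 = (q ^ 2 - 1) * k := by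
    rw [hhalf, pow_mul, hk]
    simp only [pow_mul]
    rw [mul_comm, Nat.geomSum_eq (by nlinarith [hq.two_le]), Nat.div_mul_cancel]
    simpa using Nat.sub_dvd_pow_sub_pow (q ^ 2) 1 m
  have hn0 : 0 < q ^ 2 - 1 := Nat.sub_pos_of_lt (by nlinarith [hq.two_le])
  have hβ1 := pow_sq_sub_one_eq_one_of_pow_eq_neg_one hq hβ
  rw [hn, gcd_div_orderOf_eq_div_orderOf_pow hn0 hk0 (by rw [mul_comm, pow_mul, hβ1])]
  congr 1
  have hξ := Complex.isPrimitiveRoot_exp p hp.ne_zero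
  set ξ := Complex.exp (2 * Real.pi * Complex.I / p)
  have hη := aeval_gaussPeriodProdPoly hp.pos hξ.pow_eq_one q m
  have hcop : q.Coprime p := (ZMod.isUnit_iff_coprime q p).1 hqu
  obtain ⟨φ, hφ⟩ := exists_ringHom_eq_or_mul_eq hp4 hα hdeg hζ hξ
    (P := gaussPeriodProdPoly p q m) (x := (ε : 𝓞 K) ^ classNumber K)
    (by
      rw [hη]
      exact Finset.prod_ne_zero_iff.2 fun j _ ↦
        (hξ.pow_of_coprime _ (hcop.pow_left _)).add_inv_ne_zero_of_odd hp2
          (hp.odd_of_ne_two hp2.ne'))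
    (by
      rw [hη, map_prod]
      refine Finset.prod_congr rfl fun j _ ↦ ?_
      rw [map_add, ← Complex.inv_eq_conj (by rw [norm_pow, hξ.norm'_eq_one hp.ne_zero, one_pow]),
        map_inv₀, ← Complex.inv_eq_conj (by rw [norm_pow, hξ.norm'_eq_one hp.ne_zero, one_pow]),
        inv_inv, add_comm])
    (pow_ne_zero _ ε.ne_zero)
    fun w ↦ by
      rw [hη]
      exact abs_log_norm_prod_add_inv hp8 hqu hz hχ hm hM hξ hα hdeg ε hfund w
  have hmax : (Ideal.span {(q : 𝓞 K)}).IsMaximal :=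
    ((Ideal.span_singleton_prime hinert.ne_zero).2 hinert).isMaximal
      (by simpa using hinert.ne_zero)
  rw [orderOf_mk_eq_orderOf_map hmax φ
    ((Ideal.span_singleton_le_iff_mem _).2 (by simp [RingHom.mem_ker]))]
  have hneg := orderOf_neg_eq_of_pow_eq_neg_one hq hβ
  rw [hβprod] at hφ
  rcases hφ with h | h | h | h
  · rw [h]
  · rw [← hneg, h, neg_neg]
  · exact orderOf_eq_of_mul_eq_one h
  · rw [← hneg]
    exact orderOf_eq_of_mul_eq_one (by rw [neg_mul, h, neg_neg])
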